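/- arXiv:1108.4559 — 11 statements merged into one kernel-verified Lean document; each statement's English description precedes it below -/
import Mathlib

section
/- Fix integers 1 <= k <= d and B > 0. Let w in R^d with w ≠ 0 and ||w||_2 <= B, let x in R^d with ||x||_2 <= 1, and let y in R with |y| <= B. Let g̃ = θ̃ · x̃ be the Ridge gradient estimator. Then E[g̃] = (w·x - y) · x, and E[||g̃||_2^2] <= 8 B^2 d / k. -/
open MeasureTheory
open scoped RealInnerProductSpace ENNReal

/-- The uniform probability measure on a (nonempty) finite type. -/
noncomputable def uniformM (α : Type*) [Fintype α] [MeasurableSpace α] : Measure α :=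
  (Fintype.card α : ℝ≥0∞)⁻¹ • Measure.count

/-- The sparse attribute estimator `x̃ = (1/k) Σ_{r=1}^k d · x[i_r] · e_{i_r}`. -/
noncomputable def xTil (d k : ℕ) (x : EuclideanSpace ℝ (Fin d)) (ir : Fin k → Fin d) :
    EuclideanSpace ℝ (Fin d) :=
  (k : ℝ)⁻¹ • ∑ r : Fin k, ((d : ℝ) * x (ir r)) • EuclideanSpace.single (ir r) (1 : ℝ)

/-- The importance-sampling distribution on `{1,…,d}` with `P[j = i] = w[i]²/‖w‖₂²`. -/
noncomputable def ridgeJMeasure {d : ℕ} (w : EuclideanSpace ℝ (Fin d)) : Measure (Fin d) :=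
  Measure.sum fun i => ENNReal.ofReal (w i ^ 2 / ‖w‖ ^ 2) • Measure.dirac i

/-- The residual estimator `θ̃ = ‖w‖₂²·x[j]/w[j] - y`. -/
noncomputable def thetaTil {d : ℕ} (w x : EuclideanSpace ℝ (Fin d)) (y : ℝ) (j : Fin d) : ℝ :=
  ‖w‖ ^ 2 * (x j / w j) - y

lemma avg_one {d k : ℕ} (hd : 0 < d) (f : Fin d → ℝ) (r : Fin k) :
    ((d : ℝ) ^ k)⁻¹ * ∑ ir : Fin k → Fin d, f (ir r) = (∑ i, f i) / d := by
  have hd' : (d : ℝ) ≠ 0 := by positivity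
  have h := Finset.prod_univ_sum (fun _ : Fin k => (Finset.univ : Finset (Fin d)))
    (fun t i => if t = r then f i else (1 : ℝ))
  rw [Fintype.piFinset_univ] at h
  have h1 : ∀ ir : Fin k → Fin d, (∏ t, if t = r then f (ir t) else (1 : ℝ)) = f (ir r) := by
    intro ir
    rw [Finset.prod_ite_eq' Finset.univ r (fun t => f (ir t))]
    simp
  simp only [h1] at h
  have h2 : ∀ t : Fin k, (∑ i, if t = r then f i else (1 : ℝ))
      = d * (if t = r then (∑ i, f i) / d else 1) := by
    intro t
    split_ifs
    · field_simp
    · simp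
  simp only [h2, Finset.prod_mul_distrib] at h
  rw [← h, Finset.prod_ite_eq' Finset.univ r]
  simp
  field_simp

lemma avg_two {d k : ℕ} (hd : 0 < d) (f : Fin d → ℝ) (r s : Fin k) (hrs : r ≠ s) :
    ((d : ℝ) ^ k)⁻¹ * ∑ ir : Fin k → Fin d, f (ir r) * f (ir s) = ((∑ i, f i) / d) ^ 2 := by
  have hd' : (d : ℝ) ≠ 0 := by positivity
  have h := Finset.prod_univ_sum (fun _ : Fin k => (Finset.univ : Finset (Fin d)))
    (fun t i => (if t = r then f i else (1 : ℝ)) * (if t = s then f i else (1 : ℝ)))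
  rw [Fintype.piFinset_univ] at h
  have h1 : ∀ ir : Fin k → Fin d, (∏ t, (if t = r then f (ir t) else (1 : ℝ)) *
      (if t = s then f (ir t) else (1 : ℝ))) = f (ir r) * f (ir s) := by
    intro ir
    rw [Finset.prod_mul_distrib, Finset.prod_ite_eq' Finset.univ r (fun t => f (ir t)),
      Finset.prod_ite_eq' Finset.univ s (fun t => f (ir t))]
    simp
  simp only [h1] at h
  have h2 : ∀ t : Fin k, (∑ i, (if t = r then f i else (1 : ℝ)) * (if t = s then f i else (1 : ℝ)))
      = d * ((if t = r then (∑ i, f i) / d else 1) * (if t = s then (∑ i, f i) / d else 1)) := by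
    intro t
    by_cases h1 : t = r
    · have h3 : t ≠ s := h1 ▸ hrs
      simp only [h1, hrs, if_true, if_false, mul_one]
      field_simp
    · by_cases h3 : t = s
      · simp only [h3, hrs.symm, if_true, if_false, one_mul]
        field_simp
      · simp [h1, h3]
  simp only [h2, Finset.prod_mul_distrib] at h
  rw [← h, Finset.prod_ite_eq' Finset.univ r, Finset.prod_ite_eq' Finset.univ s]
  simp
  field_simp

lemma xTil_apply (d k : ℕ) (x : EuclideanSpace ℝ (Fin d)) (ir : Fin k → Fin d) (c : Fin d) :
    xTil d k x ir c = (k : ℝ)⁻¹ * ∑ r, (if c = ir r then (d : ℝ) * x c else 0) := by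
  simp only [xTil, PiLp.smul_apply, smul_eq_mul, WithLp.ofLp_sum, Finset.sum_apply]
  congr 1
  refine Finset.sum_congr rfl fun r _ => ?_
  by_cases h : c = ir r
  · simp [← h]
  · simp [h]

lemma avg_x {d k : ℕ} (hd : 0 < d) (hk : 0 < k) (x : EuclideanSpace ℝ (Fin d)) (c : Fin d) :
    ((d : ℝ) ^ k)⁻¹ * ∑ ir : Fin k → Fin d, xTil d k x ir c = x c := by
  have hd' : (d : ℝ) ≠ 0 := by positivity
  have hk' : (k : ℝ) ≠ 0 := by positivity
  simp only [xTil_apply]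
  rw [← Finset.mul_sum, Finset.sum_comm, mul_left_comm, Finset.mul_sum]
  simp only [fun r : Fin k => avg_one hd (fun i => if c = i then (d : ℝ) * x c else 0) r]
  simp
  field_simp

lemma avg_x_sq {d k : ℕ} (hd : 0 < d) (hk : 0 < k) (x : EuclideanSpace ℝ (Fin d)) (c : Fin d) :
    ((d : ℝ) ^ k)⁻¹ * ∑ ir : Fin k → Fin d, (xTil d k x ir c) ^ 2
      = (d + k - 1) / k * x c ^ 2 := by
  have hd' : (d : ℝ) ≠ 0 := by positivity
  have hk' : (k : ℝ) ≠ 0 := by positivity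
  simp only [xTil_apply, mul_pow]
  rw [← Finset.mul_sum, mul_left_comm]
  simp only [sq (Finset.sum _ _), Finset.sum_mul_sum]
  rw [Finset.sum_comm, Finset.mul_sum]
  have key : ∀ r : Fin k, ((d : ℝ) ^ k)⁻¹ * ∑ ir : Fin k → Fin d, ∑ s : Fin k,
      (if c = ir r then (d : ℝ) * x c else 0) * (if c = ir s then (d : ℝ) * x c else 0)
      = (d + k - 1) * x c ^ 2 := by
    intro r
    rw [Finset.sum_comm, Finset.mul_sum]
    have : ∀ s : Fin k, ((d : ℝ) ^ k)⁻¹ * ∑ ir : Fin k → Fin d,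
      (if c = ir r then (d : ℝ) * x c else 0) * (if c = ir s then (d : ℝ) * x c else 0)
      = x c ^ 2 + if r = s then (d - 1) * x c ^ 2 else 0 := by
      intro s
      by_cases h : r = s
      · subst h
        rw [avg_one hd (fun i => (if c = i then (d : ℝ) * x c else 0) *
          (if c = i then (d : ℝ) * x c else 0)) r]
        simp
        field_simp
        ring
      · rw [avg_two hd (fun i => (if c = i then (d : ℝ) * x c else 0)) r s h]
        simp [h]
        field_simp
    simp only [this, Finset.sum_add_distrib]
    simp
    ring
  simp only [key]
  simp
  field_simp

lemma uniform_real {d k : ℕ} (hd : 0 < d) (ir : Fin k → Fin d) :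
    (uniformM (Fin k → Fin d)).real {ir} = ((d : ℝ) ^ k)⁻¹ := by
  simp [uniformM, Measure.real]

instance {d : ℕ} (w : EuclideanSpace ℝ (Fin d)) : IsFiniteMeasure (ridgeJMeasure w) := by
  refine ⟨?_⟩
  simp [ridgeJMeasure, ENNReal.sum_lt_top]

lemma ridge_real {d : ℕ} (w : EuclideanSpace ℝ (Fin d)) (j : Fin d) :
    (ridgeJMeasure w).real {j} = w j ^ 2 / ‖w‖ ^ 2 := by
  have : ridgeJMeasure w {j} = ENNReal.ofReal (w j ^ 2 / ‖w‖ ^ 2) := by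
    simp only [ridgeJMeasure]
    rw [Measure.sum_apply _ (measurableSet_singleton j), tsum_fintype,
      Finset.sum_eq_single j]
    · simp
    · intro b _ hb
      simp [hb]
    · simp
  rw [Measure.real, this, ENNReal.toReal_ofReal (by positivity)]

lemma ridge_integral {d k : ℕ} (hd : 0 < d) (w : EuclideanSpace ℝ (Fin d))
    {E : Type*} [NormedAddCommGroup E] [NormedSpace ℝ E] [CompleteSpace E]
    (a : Fin d → ℝ) (b : (Fin k → Fin d) → E) :
    (∫ q : (Fin k → Fin d) × Fin d, a q.2 • b q.1
        ∂(uniformM (Fin k → Fin d)).prod (ridgeJMeasure w)) =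
      (∑ j, w j ^ 2 / ‖w‖ ^ 2 * a j) • (((d : ℝ) ^ k)⁻¹ • ∑ ir, b ir) := by
  haveI : Nonempty (Fin d) := ⟨⟨0, hd⟩⟩
  haveI : IsFiniteMeasure (uniformM (Fin k → Fin d)) := by
    refine ⟨?_⟩
    simp only [uniformM, Measure.smul_apply, smul_eq_mul]
    refine ENNReal.mul_lt_top ?_ (measure_lt_top _ _)
    simp only [Fintype.card_fun, Fintype.card_fin, ENNReal.inv_lt_top]
    exact_mod_cast Nat.pow_pos hd
  rw [integral_fintype (Integrable.of_finite)]
  have hq : ∀ q : (Fin k → Fin d) × Fin d,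
      ((uniformM (Fin k → Fin d)).prod (ridgeJMeasure w)).real {q}
        = ((d : ℝ) ^ k)⁻¹ * (w q.2 ^ 2 / ‖w‖ ^ 2) := by
    rintro ⟨u, v⟩
    rw [← Set.singleton_prod_singleton, measureReal_prod_prod, uniform_real hd, ridge_real]
  simp only [hq]
  rw [Fintype.sum_prod_type]
  simp only [Finset.smul_sum, smul_smul]
  refine Finset.sum_congr rfl fun u _ => ?_
  rw [← Finset.sum_smul, Finset.sum_mul]
  congr 1
  refine Finset.sum_congr rfl fun v _ => ?_
  ring

/-- The Ridge gradient estimator `g̃ = θ̃·x̃`, where `x̃` is built from `k`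
i.i.d. uniform attribute samples and `θ̃` from an independent importance sample `j` with
`P[j = i] = w[i]²/‖w‖₂²`, satisfies `E[g̃] = (w·x - y)·x` and `E[‖g̃‖₂²] ≤ 8B²d/k`, whenever
`w ≠ 0`, `‖w‖₂ ≤ B`, `‖x‖₂ ≤ 1`, `|y| ≤ B` and `1 ≤ k ≤ d`. -/
theorem stmt5 (d k : ℕ) (hk1 : 1 ≤ k) (hkd : k ≤ d) (B : ℝ) (hB : 0 < B)
    (w x : EuclideanSpace ℝ (Fin d)) (hw0 : w ≠ 0) (hwB : ‖w‖ ≤ B)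
    (hx : ‖x‖ ≤ 1) (y : ℝ) (hy : |y| ≤ B) :
    (∫ q : (Fin k → Fin d) × Fin d, thetaTil w x y q.2 • xTil d k x q.1
        ∂(uniformM (Fin k → Fin d)).prod (ridgeJMeasure w)) = (⟪w, x⟫ - y) • x ∧
      (∫ q : (Fin k → Fin d) × Fin d, ‖thetaTil w x y q.2 • xTil d k x q.1‖ ^ 2
          ∂(uniformM (Fin k → Fin d)).prod (ridgeJMeasure w)) ≤
        8 * B ^ 2 * d / k := by
  have hd : 0 < d := by omega
  have hk : 0 < k := by omega
  have hW : 0 < ‖w‖ := norm_pos_iff.mpr hw0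
  have hWs : ∑ j, w j ^ 2 = ‖w‖ ^ 2 := (EuclideanSpace.real_norm_sq_eq w).symm
  have hXs : ∑ j, x j ^ 2 = ‖x‖ ^ 2 := (EuclideanSpace.real_norm_sq_eq x).symm
  have hp : ∑ j, w j ^ 2 / ‖w‖ ^ 2 = 1 := by
    rw [← Finset.sum_div, hWs]
    field_simp
  constructor
  · rw [ridge_integral hd w (thetaTil w x y) (xTil d k x)]
    have h1 : ((d : ℝ) ^ k)⁻¹ • ∑ ir : Fin k → Fin d, xTil d k x ir = x := by
      ext c
      simpa using avg_x hd hk x c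
    have h2 : ∑ j, w j ^ 2 / ‖w‖ ^ 2 * thetaTil w x y j = ⟪w, x⟫ - y := by
      have : ∀ j, w j ^ 2 / ‖w‖ ^ 2 * thetaTil w x y j = w j * x j - w j ^ 2 / ‖w‖ ^ 2 * y := by
        intro j
        unfold thetaTil
        by_cases h : w j = 0
        · simp [h]
        · field_simp
      simp only [this]
      rw [Finset.sum_sub_distrib, ← Finset.sum_mul, hp, one_mul, PiLp.inner_apply]
      simp [mul_comm]
    rw [h1, h2]
  · simp only [norm_smul, mul_pow]
    have h0 := ridge_integral hd w (fun j => ‖thetaTil w x y j‖ ^ 2) (fun ir => ‖xTil d k x ir‖ ^ 2)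
    simp only [smul_eq_mul] at h0
    rw [h0]
    have h1 : ((d : ℝ) ^ k)⁻¹ * ∑ ir : Fin k → Fin d, ‖xTil d k x ir‖ ^ 2
        = (d + k - 1) / k * ‖x‖ ^ 2 := by
      simp only [EuclideanSpace.real_norm_sq_eq]
      rw [Finset.sum_comm, Finset.mul_sum, Finset.mul_sum]
      exact Finset.sum_congr rfl fun c _ => avg_x_sq hd hk x c
    have hx2 : ‖x‖ ^ 2 ≤ 1 := pow_le_one₀ (norm_nonneg _) hx
    have hw2 : ‖w‖ ^ 2 ≤ B ^ 2 := pow_le_pow_left₀ (norm_nonneg _) hwB 2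
    have hy2 : y ^ 2 ≤ B ^ 2 := sq_le_sq' (abs_le.mp hy).1 (abs_le.mp hy).2
    have hk' : (0 : ℝ) < k := by positivity
    have hkd' : (k : ℝ) ≤ d := by exact_mod_cast hkd
    have hk1' : (1 : ℝ) ≤ k := by exact_mod_cast hk1
    have h2 : (d + k - 1) / k * ‖x‖ ^ 2 ≤ 2 * (d : ℝ) / k := by
      calc (d + k - 1) / k * ‖x‖ ^ 2 ≤ ((d : ℝ) + k - 1) / k * 1 := by
            refine mul_le_mul_of_nonneg_left hx2 (div_nonneg ?_ hk'.le)
            linarith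
        _ ≤ _ := by
            rw [mul_one]
            exact div_le_div_of_nonneg_right (by linarith) hk'.le
    have h3 : ∑ j, w j ^ 2 / ‖w‖ ^ 2 * ‖thetaTil w x y j‖ ^ 2 ≤ 4 * B ^ 2 := by
      have : ∀ j, w j ^ 2 / ‖w‖ ^ 2 * ‖thetaTil w x y j‖ ^ 2
          ≤ 2 * ‖w‖ ^ 2 * x j ^ 2 + w j ^ 2 / ‖w‖ ^ 2 * (2 * y ^ 2) := by
        intro j
        rw [Real.norm_eq_abs, sq_abs]
        unfold thetaTil
        by_cases h : w j = 0
        · simp [h]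
          positivity
        · have e : 2 * ‖w‖ ^ 2 * x j ^ 2 + w j ^ 2 / ‖w‖ ^ 2 * (2 * y ^ 2)
            = w j ^ 2 / ‖w‖ ^ 2 * (2 * (‖w‖ ^ 2 * (x j / w j)) ^ 2 + 2 * y ^ 2) := by
            field_simp
          rw [e]
          refine mul_le_mul_of_nonneg_left ?_ (by positivity)
          nlinarith [sq_nonneg (‖w‖ ^ 2 * (x j / w j) + y)]
      refine (Finset.sum_le_sum fun j _ => this j).trans ?_
      rw [Finset.sum_add_distrib, ← Finset.mul_sum, ← Finset.sum_mul, hp, hXs]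
      nlinarith [mul_le_mul_of_nonneg_left hx2 (sq_nonneg ‖w‖)]
    rw [h1]
    calc _ ≤ 4 * B ^ 2 * (2 * (d : ℝ) / k) := by
          refine mul_le_mul h3 h2 ?_ (by positivity)
          refine mul_nonneg (div_nonneg ?_ hk'.le) (by positivity)
          linarith
      _ = _ := by ring
end

section
/- Fix integers 1 <= k <= d. Let x in R^d, let i_1, ..., i_k be i.i.d. uniform on {1,...,d}, and let x̃ = (1/k) Σ_{r=1}^k d · x[i_r] · e_{i_r}. Then E[x̃] = x and E[||x̃||_2^2] <= (2d/k) ||x||_2^2. -/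
open MeasureTheory
open scoped ENNReal

lemma sum_cons_aux {M : Type*} [AddCommMonoid M] (d k : ℕ) (f : (Fin (k+1) → Fin d) → M) :
    ∑ ir, f ir = ∑ i : Fin d, ∑ q : Fin k → Fin d, f (Fin.cons i q) := by
  rw [← Fintype.sum_prod_type' (f := fun i q => f (Fin.cons i q))]
  exact (Fintype.sum_equiv (Fin.consEquiv (fun _ : Fin (k+1) => Fin d)) _ _ (fun p => rfl)).symm

lemma sumA_aux {E : Type*} [NormedAddCommGroup E] [InnerProductSpace ℝ E] (d : ℕ)
    (w : Fin d → E) (x : E) (hw : ∑ i, w i = (d : ℝ) • x) (k : ℕ) :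
    ∑ ir : Fin k → Fin d, ∑ r, w (ir r) = ((k : ℝ) * (d : ℝ) ^ k) • x := by
  induction k with
  | zero => simp
  | succ k ih =>
    rw [sum_cons_aux]
    simp only [Fin.sum_univ_succ, Fin.cons_zero, Fin.cons_succ, Finset.sum_add_distrib, ih,
      Finset.sum_const, ← Finset.smul_sum, hw, Finset.card_univ, Fintype.card_fun,
      Fintype.card_fin, ← Nat.cast_smul_eq_nsmul ℝ, smul_smul, ← add_smul]
    congr 1
    push_cast
    ring

lemma sumB_aux {E : Type*} [NormedAddCommGroup E] [InnerProductSpace ℝ E] (d : ℕ)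
    (w : Fin d → E) (x : E) (hw : ∑ i, w i = (d : ℝ) • x)
    (hw2 : ∑ i, ‖w i‖ ^ 2 = (d : ℝ) ^ 2 * ‖x‖ ^ 2) (k : ℕ) :
    ∑ ir : Fin k → Fin d, ‖∑ r, w (ir r)‖ ^ 2
      = (d : ℝ) ^ k * ((k : ℝ) * d + k * (k - 1)) * ‖x‖ ^ 2 := by
  induction k with
  | zero => simp
  | succ k ih =>
    rw [sum_cons_aux]
    simp only [Fin.sum_univ_succ, Fin.cons_zero, Fin.cons_succ, norm_add_sq_real,
      Finset.sum_add_distrib, ih, ← Finset.mul_sum, ← inner_sum, ← sum_inner,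
      sumA_aux d w x hw, hw, Finset.sum_const, hw2, Finset.card_univ, Fintype.card_fun,
      Fintype.card_fin, nsmul_eq_mul, real_inner_smul_left, real_inner_smul_right,
      real_inner_self_eq_norm_sq]
    push_cast
    ring

lemma integral_aux {E : Type*} [NormedAddCommGroup E] [NormedSpace ℝ E] [CompleteSpace E] (d k : ℕ)
    (f : (Fin k → Fin d) → E) :
    ∫ ir, f ir ∂uniformM (Fin k → Fin d) = ((d : ℝ) ^ k)⁻¹ • ∑ ir, f ir := by
  rw [uniformM, integral_smul_measure, integral_count]
  simp

/-- If `i_1, …, i_k` are i.i.d. uniform on `{1,…,d}` (their joint law being the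
uniform measure on `Fin k → Fin d`) and `x̃ = (1/k) Σ_r d·x[i_r]·e_{i_r}`, then `E[x̃] = x` and
`E[‖x̃‖₂²] ≤ (2d/k)‖x‖₂²`. -/
theorem stmt6 (d k : ℕ) (hk1 : 1 ≤ k) (hkd : k ≤ d) (x : EuclideanSpace ℝ (Fin d)) :
    (∫ ir : Fin k → Fin d, xTil d k x ir ∂uniformM (Fin k → Fin d)) = x ∧
      (∫ ir : Fin k → Fin d, ‖xTil d k x ir‖ ^ 2 ∂uniformM (Fin k → Fin d)) ≤
        2 * d / k * ‖x‖ ^ 2 := by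
  have hd : (d : ℝ) ≠ 0 := by
    have : d ≠ 0 := by omega
    exact_mod_cast this
  have hk : (k : ℝ) ≠ 0 := by
    have : k ≠ 0 := by omega
    exact_mod_cast this
  have hkp : (0 : ℝ) < k := by exact_mod_cast hk1
  have hkd' : (k : ℝ) ≤ d := by exact_mod_cast hkd
  have hw : ∑ i : Fin d, ((d : ℝ) * x i) • EuclideanSpace.single i (1 : ℝ) = (d : ℝ) • x := by
    ext j
    simp [Pi.single_apply]
  have hw2 : ∑ i : Fin d, ‖((d : ℝ) * x i) • EuclideanSpace.single i (1 : ℝ)‖ ^ 2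
      = (d : ℝ) ^ 2 * ‖x‖ ^ 2 := by
    simp [EuclideanSpace.norm_sq_eq, norm_smul, mul_pow, Finset.mul_sum]
  rw [integral_aux, integral_aux]
  have hA := sumA_aux d (fun i => ((d : ℝ) * x i) • EuclideanSpace.single i (1 : ℝ)) x hw k
  have hB := sumB_aux d (fun i => ((d : ℝ) * x i) • EuclideanSpace.single i (1 : ℝ)) x hw hw2 k
  constructor
  · simp only [xTil]
    rw [← Finset.smul_sum, hA, smul_smul, smul_smul]
    convert one_smul ℝ x using 2
    field_simp
  · simp only [xTil, norm_smul _ (∑ r : Fin k, _), mul_pow]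
    rw [← Finset.mul_sum, hB, smul_eq_mul]
    have e : ((d : ℝ) ^ k)⁻¹ * (‖(k : ℝ)⁻¹‖ ^ 2 *
        ((d : ℝ) ^ k * ((k : ℝ) * d + k * (k - 1)) * ‖x‖ ^ 2))
        = (d + (k - 1)) / k * ‖x‖ ^ 2 := by
      rw [Real.norm_eq_abs, sq_abs]
      field_simp
    rw [e]
    gcongr
    linarith
end

section
/- Let B > 0, let w in R^d with w ≠ 0 and ||w||_2 <= B, let x in R^d with ||x||_2 <= 1, and let y in R with |y| <= B. Sample j in {1,...,d} with P[j = i] = w[i]^2 / ||w||_2^2, and set θ̃ = ||w||_2^2 · x[j] / w[j] - y. Then E[θ̃] = w·x - y, and E[θ̃^2] <= 2(||w||_2^2 ||x||_2^2 + y^2) <= 4 B^2. -/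
open MeasureTheory
open scoped RealInnerProductSpace ENNReal

theorem ridge_integral_s7 {d : ℕ} (w : EuclideanSpace ℝ (Fin d)) (f : Fin d → ℝ) :
    ∫ j, f j ∂ridgeJMeasure w = ∑ i, w i ^ 2 / ‖w‖ ^ 2 * f i := by
  unfold ridgeJMeasure
  rw [Measure.sum_fintype, integral_finset_sum_measure]
  · refine Finset.sum_congr rfl fun i _ => ?_
    rw [integral_smul_measure, integral_dirac, ENNReal.toReal_ofReal (by positivity), smul_eq_mul]
  · intro i _
    exact (integrable_dirac (by simp)).smul_measure ENNReal.ofReal_ne_top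

/-- Importance-sampling estimator of the residual: for `w ≠ 0`, `‖w‖₂ ≤ B`,
`‖x‖₂ ≤ 1`, `|y| ≤ B`, sampling `j` with `P[j = i] = w[i]²/‖w‖₂²` and setting
`θ̃ = ‖w‖₂²·x[j]/w[j] - y`, one has `E[θ̃] = w·x - y` and
`E[θ̃²] ≤ 2(‖w‖₂²‖x‖₂² + y²) ≤ 4B²`. -/
theorem stmt7 (d : ℕ) (B : ℝ) (hB : 0 < B)
    (w x : EuclideanSpace ℝ (Fin d)) (hw0 : w ≠ 0) (hwB : ‖w‖ ≤ B)
    (hx : ‖x‖ ≤ 1) (y : ℝ) (hy : |y| ≤ B) :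
    (∫ j, (‖w‖ ^ 2 * (x j / w j) - y) ∂ridgeJMeasure w) = ⟪w, x⟫ - y ∧
      (∫ j, (‖w‖ ^ 2 * (x j / w j) - y) ^ 2 ∂ridgeJMeasure w) ≤
          2 * (‖w‖ ^ 2 * ‖x‖ ^ 2 + y ^ 2) ∧
        2 * (‖w‖ ^ 2 * ‖x‖ ^ 2 + y ^ 2) ≤ 4 * B ^ 2 := by
  have hn : 0 < ‖w‖ := norm_pos_iff.mpr hw0
  have hsw : ∑ i, w i ^ 2 = ‖w‖ ^ 2 := by rw [EuclideanSpace.real_norm_sq_eq]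
  have hsx : ∑ i, x i ^ 2 = ‖x‖ ^ 2 := by rw [EuclideanSpace.real_norm_sq_eq]
  have hp : ∑ i, w i ^ 2 / ‖w‖ ^ 2 = 1 := by
    rw [← Finset.sum_div, hsw, div_self (by positivity)]
  refine ⟨?_, ?_, ?_⟩
  · rw [ridge_integral_s7]
    have h : ∀ i, w i ^ 2 / ‖w‖ ^ 2 * (‖w‖ ^ 2 * (x i / w i) - y)
        = w i * x i - w i ^ 2 / ‖w‖ ^ 2 * y := by
      intro i
      by_cases hi : w i = 0
      · simp [hi]
      · field_simp
    simp_rw [h]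
    rw [Finset.sum_sub_distrib, ← Finset.sum_mul, hp, one_mul, PiLp.inner_apply]
    simp [mul_comm]
  · rw [ridge_integral_s7]
    have h : ∀ i, w i ^ 2 / ‖w‖ ^ 2 * (‖w‖ ^ 2 * (x i / w i) - y) ^ 2
        ≤ 2 * (‖w‖ ^ 2 * x i ^ 2) + w i ^ 2 / ‖w‖ ^ 2 * (2 * y ^ 2) := by
      intro i
      by_cases hi : w i = 0
      · simp [hi]
        positivity
      · have h1 : w i ^ 2 / ‖w‖ ^ 2 * (‖w‖ ^ 2 * (x i / w i)) ^ 2 = ‖w‖ ^ 2 * x i ^ 2 := by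
          field_simp
        have h2 : 0 ≤ w i ^ 2 / ‖w‖ ^ 2 * (‖w‖ ^ 2 * (x i / w i) + y) ^ 2 := by positivity
        rw [← h1]
        linarith
    refine (Finset.sum_le_sum fun i _ => h i).trans (le_of_eq ?_)
    rw [Finset.sum_add_distrib, ← Finset.sum_mul, hp, ← Finset.mul_sum, ← Finset.mul_sum, hsx]
    ring
  · have h1 : ‖w‖ ^ 2 ≤ B ^ 2 := by gcongr
    have h2 : ‖x‖ ^ 2 ≤ 1 := pow_le_one₀ (norm_nonneg _) hx
    have h3 : y ^ 2 ≤ B ^ 2 := sq_le_sq' (abs_le.mp hy).1 (abs_le.mp hy).2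
    have h4 : ‖w‖ ^ 2 * ‖x‖ ^ 2 ≤ B ^ 2 * 1 := by gcongr
    linarith
end

section
/- Let η > 0 and let c_1, ..., c_T be vectors in R^n with c_t[i] >= -1/η for all t and i. Define z_1 = 1_n (the all-ones vector), z_{t+1}[i] = z_t[i] · exp(-η c_t[i]) for all i and t >= 1, and p_t = z_t / ||z_t||_1. Then Σ_{t=1}^T p_t · c_t <= min_{i in [n]} Σ_{t=1}^T c_t[i] + (log n)/η + η Σ_{t=1}^T p_t · c_t^2, where c_t^2 denotes the entrywise square of c_t. -/
theorem exp_le_quad (x : ℝ) (hx : x ≤ 1) : Real.exp x ≤ 1 + x + x ^ 2 := by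
  by_cases h : -1 ≤ x
  · have := Real.abs_exp_sub_one_sub_id_le (abs_le.mpr ⟨h, hx⟩)
    linarith [(abs_le.mp this).2]
  · have h1 : Real.exp x ≤ 1 := Real.exp_le_one_iff.mpr (by linarith)
    nlinarith

/-- Second-order regret bound for the multiplicative-weights algorithm:
if `c_1, …, c_T` are vectors in `ℝⁿ` with entries bounded below by `-1/η`,
`z_1 = 1ₙ`, `z_{t+1}[i] = z_t[i]·exp(-η c_t[i])` and `p_t = z_t/‖z_t‖₁`, then
`Σ_t p_t·c_t ≤ min_i Σ_t c_t[i] + (log n)/η + η Σ_t p_t·c_t²`. -/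
theorem stmt8 (n : ℕ) (hn : 1 ≤ n) (T : ℕ) (η : ℝ) (hη : 0 < η)
    (c : ℕ → Fin n → ℝ) (hc : ∀ t ∈ Finset.Icc 1 T, ∀ i, -(1 / η) ≤ c t i)
    (z : ℕ → Fin n → ℝ) (hz1 : ∀ i, z 1 i = 1)
    (hzrec : ∀ t ∈ Finset.Icc 1 T, ∀ i, z (t + 1) i = z t i * Real.exp (-(η * c t i)))
    (p : ℕ → Fin n → ℝ) (hp : ∀ t i, p t i = z t i / ∑ j, |z t j|) :
    (∑ t ∈ Finset.Icc 1 T, ∑ i, p t i * c t i) ≤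
      (⨅ i : Fin n, ∑ t ∈ Finset.Icc 1 T, c t i) + Real.log n / η +
        η * ∑ t ∈ Finset.Icc 1 T, ∑ i, p t i * (c t i) ^ 2 := by
  have hzk : ∀ k ≤ T, ∀ i, z (k + 1) i = Real.exp (-(η * ∑ t ∈ Finset.Icc 1 k, c t i)) := by
    intro k
    induction k with
    | zero => intro _ i; simp [hz1]
    | succ k ih =>
      intro hk i
      rw [hzrec (k + 1) (Finset.mem_Icc.mpr ⟨by omega, hk⟩) i, ih (by omega) i, ← Real.exp_add,
        Finset.sum_Icc_succ_top (by omega)]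
      congr 1
      ring
  have : Nonempty (Fin n) := ⟨⟨0, by omega⟩⟩
  have hW : ∀ k ≤ T, ∑ i, z (k + 1) i ≤ n * Real.exp
      (-(η * ∑ t ∈ Finset.Icc 1 k, ∑ i, p t i * c t i) +
        η ^ 2 * ∑ t ∈ Finset.Icc 1 k, ∑ i, p t i * (c t i) ^ 2) := by
    intro k
    induction k with
    | zero => intro _; simp [hz1]
    | succ k ih =>
      intro hk
      have hmem : k + 1 ∈ Finset.Icc 1 T := Finset.mem_Icc.mpr ⟨by omega, hk⟩
      have hpos : ∀ i, 0 < z (k + 1) i := fun i => by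
        rw [hzk k (by omega) i]; exact Real.exp_pos _
      have hWpos : 0 < ∑ i, z (k + 1) i :=
        Finset.sum_pos (fun i _ => hpos i) Finset.univ_nonempty
      have habs : ∑ j, |z (k + 1) j| = ∑ j, z (k + 1) j :=
        Finset.sum_congr rfl fun j _ => abs_of_pos (hpos j)
      have hzp : ∀ i, z (k + 1) i = (∑ j, z (k + 1) j) * p (k + 1) i := fun i => by
        rw [hp, habs, mul_div_cancel₀ _ hWpos.ne']
      set W := ∑ j, z (k + 1) j with hWdef
      have h1 : ∑ i, z (k + 1 + 1) i ≤
          W * ((-(η * ∑ i, p (k + 1) i * c (k + 1) i) +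
            η ^ 2 * ∑ i, p (k + 1) i * (c (k + 1) i) ^ 2) + 1) := by
        calc ∑ i, z (k + 1 + 1) i
            ≤ ∑ i, (z (k + 1) i + (-(W * η) * (p (k + 1) i * c (k + 1) i) +
                W * η ^ 2 * (p (k + 1) i * (c (k + 1) i) ^ 2))) := by
              apply Finset.sum_le_sum
              intro i _
              rw [hzrec (k + 1) hmem i]
              have hx : -(η * c (k + 1) i) ≤ 1 := by
                have h2 := mul_le_mul_of_nonneg_left (hc (k + 1) hmem i) hη.le
                have h3 : η * -(1 / η) = -1 := by field_simp
                linarith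
              refine (mul_le_mul_of_nonneg_left (exp_le_quad _ hx) (hpos i).le).trans
                (le_of_eq ?_)
              rw [hzp i]
              ring
          _ = _ := by
              rw [Finset.sum_add_distrib, Finset.sum_add_distrib, ← Finset.mul_sum,
                ← Finset.mul_sum, ← hWdef]
              ring
      refine h1.trans ((mul_le_mul_of_nonneg_left (Real.add_one_le_exp _) hWpos.le).trans
        ((mul_le_mul_of_nonneg_right (ih (by omega)) (Real.exp_pos _).le).trans (le_of_eq ?_)))
      rw [mul_assoc, ← Real.exp_add, Finset.sum_Icc_succ_top (by omega),
        Finset.sum_Icc_succ_top (by omega)]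
      congr 2
      ring
  have hn0 : (0 : ℝ) < n := by exact_mod_cast hn
  have key : (∑ t ∈ Finset.Icc 1 T, ∑ i, p t i * c t i) - Real.log n / η -
      η * ∑ t ∈ Finset.Icc 1 T, ∑ i, p t i * (c t i) ^ 2 ≤
      ⨅ i : Fin n, ∑ t ∈ Finset.Icc 1 T, c t i := by
    apply le_ciInf
    intro i
    have h1 : z (T + 1) i ≤ ∑ j, z (T + 1) j :=
      Finset.single_le_sum (f := fun j => z (T + 1) j)
        (fun j _ => by rw [hzk T le_rfl j]; exact (Real.exp_pos _).le) (Finset.mem_univ i)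
    have h2 := h1.trans (hW T le_rfl)
    rw [hzk T le_rfl i, ← Real.exp_log hn0, ← Real.exp_add, Real.exp_le_exp] at h2
    have h3 : η * (Real.log n / η) = Real.log n := by field_simp
    refine le_of_mul_le_mul_left ?_ hη
    rw [mul_sub, mul_sub, h3]
    nlinarith
  linarith
end

section
/- Let B, G, η > 0, let (F_t)_{t=0..m} be a filtration, and let g̃_1, ..., g̃_m be random vectors in R^d such that g̃_t is F_t-measurable and ||E[g̃_t^2 | F_{t-1}]||_∞ <= G^2 for all t, where g̃_t^2 is the entrywise square. Define ḡ_t[i] = clip(g̃_t[i], 1/η), z⁺_1 = z⁻_1 = 1_d, z⁺_{t+1}[i] = z⁺_t[i] exp(-η ḡ_t[i]), z⁻_{t+1}[i] = z⁻_t[i] exp(+η ḡ_t[i]), and w_t = B (z⁺_t - z⁻_t)/(||z⁺_t||_1 + ||z⁻_t||_1) (so w_t is F_{t-1}-measurable). Then for every w* in R^d with ||w*||_1 <= B, E[Σ_{t=1}^m ḡ_t · w_t] <= E[Σ_{t=1}^m ḡ_t · w*] + B((log 2d)/η + η G^2 m). -/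
open MeasureTheory

/-- `clip(x, c) = max(min(x, c), -c)`. -/
def clip (x c : ℝ) : ℝ := max (min x c) (-c)

lemma aelr_exp_le (x : ℝ) (h : |x| ≤ 1) : Real.exp x ≤ 1 + x + x ^ 2 := by
  have := Real.abs_exp_sub_one_sub_id_le h
  have := (abs_le.1 this).2
  linarith

lemma aelr_det (d m : ℕ) (hd : 1 ≤ d) (B η : ℝ) (hB : 0 < B) (hη : 0 < η)
    (a p n w : ℕ → Fin d → ℝ) (ha : ∀ t i, |η * a t i| ≤ 1)
    (hp1 : ∀ i, p 1 i = 1) (hn1 : ∀ i, n 1 i = 1)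
    (hp : ∀ t ∈ Finset.Icc 1 m, ∀ i, p (t + 1) i = p t i * Real.exp (-(η * a t i)))
    (hn : ∀ t ∈ Finset.Icc 1 m, ∀ i, n (t + 1) i = n t i * Real.exp (η * a t i))
    (hw : ∀ t i, w t i = B * (p t i - n t i) / ((∑ j, |p t j|) + ∑ j, |n t j|))
    (u : Fin d → ℝ) (hu : (∑ i, |u i|) ≤ B) :
    (∑ t ∈ Finset.Icc 1 m, ∑ i, a t i * w t i) ≤
      (∑ t ∈ Finset.Icc 1 m, ∑ i, a t i * u i) + B * (Real.log (2 * d) / η) +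
      B * η * ∑ t ∈ Finset.Icc 1 m, ∑ i,
        (p t i + n t i) / ((∑ j, |p t j|) + ∑ j, |n t j|) * (a t i) ^ 2 := by
  have hne : Nonempty (Fin d) := ⟨⟨0, hd⟩⟩
  have key : ∀ k ≤ m, (∀ i, p (k + 1) i = Real.exp (-(η * ∑ t ∈ Finset.Icc 1 k, a t i))) ∧
      (∀ i, n (k + 1) i = Real.exp (η * ∑ t ∈ Finset.Icc 1 k, a t i)) ∧
      (∑ i, (p (k + 1) i + n (k + 1) i)) ≤ 2 * d * Real.exp (∑ t ∈ Finset.Icc 1 k,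
        (-(η / B * ∑ i, a t i * w t i) + η ^ 2 * ∑ i,
        (p t i + n t i) / ((∑ j, |p t j|) + ∑ j, |n t j|) * (a t i) ^ 2)) := by
    intro k
    induction k with
    | zero => intro _; simp [hp1, hn1]; linarith
    | succ k ih =>
      intro hk
      obtain ⟨h1, h2, h3⟩ := ih (by omega)
      have hm : k + 1 ∈ Finset.Icc 1 m := by simp; omega
      refine ⟨fun i => ?_, fun i => ?_, ?_⟩
      · rw [hp _ hm, h1, Finset.sum_Icc_succ_top (by omega), ← Real.exp_add]; ring_nf
      · rw [hn _ hm, h2, Finset.sum_Icc_succ_top (by omega), ← Real.exp_add]; ring_nf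
      · have pp : ∀ i, 0 < p (k + 1) i := fun i => by rw [h1]; positivity
        have np : ∀ i, 0 < n (k + 1) i := fun i => by rw [h2]; positivity
        have hZ : (∑ j, |p (k + 1) j|) + ∑ j, |n (k + 1) j| = ∑ i, (p (k + 1) i + n (k + 1) i) := by
          rw [Finset.sum_add_distrib]; simp only [abs_of_pos (pp _), abs_of_pos (np _)]
        have hZp : 0 < ∑ i, (p (k + 1) i + n (k + 1) i) :=
          Finset.sum_pos (fun i _ => add_pos (pp i) (np i)) Finset.univ_nonempty
        rw [Finset.sum_Icc_succ_top (by omega), Real.exp_add, ← mul_assoc]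
        refine le_trans ?_ (mul_le_mul_of_nonneg_right h3 (Real.exp_pos _).le)
        refine le_trans ?_ (mul_le_mul_of_nonneg_left (Real.add_one_le_exp _) hZp.le)
        simp only [hw, hZ]
        set Z := ∑ i, (p (k + 1) i + n (k + 1) i) with hZd
        have e : Z * (-(η / B * ∑ i, a (k + 1) i * (B * (p (k + 1) i - n (k + 1) i) / Z)) +
          η ^ 2 * ∑ i, (p (k + 1) i + n (k + 1) i) / Z * a (k + 1) i ^ 2 + 1)
          = ∑ i, (p (k+1) i * (1 + (-(η * a (k+1) i)) + (-(η * a (k+1) i))^2) +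
             n (k+1) i * (1 + (η * a (k+1) i) + (η * a (k+1) i)^2)) := by
          have e1 : Z * (η / B * ∑ i, a (k + 1) i * (B * (p (k + 1) i - n (k + 1) i) / Z))
             = ∑ i, η * a (k+1) i * (p (k + 1) i - n (k + 1) i) := by
            rw [Finset.mul_sum, Finset.mul_sum]
            refine Finset.sum_congr rfl fun i _ => ?_
            field_simp
          have e2 : Z * (η ^ 2 * ∑ i, (p (k + 1) i + n (k + 1) i) / Z * a (k + 1) i ^ 2)
             = ∑ i, η ^ 2 * (p (k + 1) i + n (k + 1) i) * a (k + 1) i ^ 2 := by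
            rw [Finset.mul_sum, Finset.mul_sum]
            refine Finset.sum_congr rfl fun i _ => ?_
            field_simp
          rw [mul_add, mul_add, mul_neg, e1, e2, mul_one, hZd, ← Finset.sum_neg_distrib,
            ← Finset.sum_add_distrib, ← Finset.sum_add_distrib]
          refine Finset.sum_congr rfl fun i _ => ?_
          ring
        rw [e]
        refine Finset.sum_le_sum fun i _ => ?_
        rw [hp _ hm, hn _ hm]
        refine add_le_add (mul_le_mul_of_nonneg_left (aelr_exp_le _ ?_) (pp i).le)
          (mul_le_mul_of_nonneg_left (aelr_exp_le _ (ha _ _)) (np i).le)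
        rw [abs_neg]; exact ha _ _
  obtain ⟨h1, h2, h3⟩ := key m le_rfl
  set L := Real.log (2 * d) + ∑ t ∈ Finset.Icc 1 m,
        (-(η / B * ∑ i, a t i * w t i) + η ^ 2 * ∑ i,
        (p t i + n t i) / ((∑ j, |p t j|) + ∑ j, |n t j|) * (a t i) ^ 2) with hL
  have hd0 : (0 : ℝ) < 2 * d := by
    have : (0 : ℝ) < d := by exact_mod_cast hd
    linarith
  have h4 : (∑ i, (p (m + 1) i + n (m + 1) i)) ≤ Real.exp L := by
    rw [hL, Real.exp_add, Real.exp_log hd0]; exact h3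
  have h5 : ∀ i, |∑ t ∈ Finset.Icc 1 m, a t i| ≤ L / η := by
    intro i
    have pp : ∀ i, 0 < p (m + 1) i := fun i => by rw [h1]; positivity
    have np : ∀ i, 0 < n (m + 1) i := fun i => by rw [h2]; positivity
    have h6 := (Finset.single_le_sum (f := fun i => p (m + 1) i + n (m + 1) i)
      (fun i _ => (add_pos (pp i) (np i)).le) (Finset.mem_univ i)).trans h4
    have h7 : p (m + 1) i ≤ Real.exp L := by linarith [np i]
    have h8 : n (m + 1) i ≤ Real.exp L := by linarith [pp i]
    rw [h1, Real.exp_le_exp] at h7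
    rw [h2, Real.exp_le_exp] at h8
    rw [le_div_iff₀ hη, ← abs_of_pos hη, ← abs_mul, abs_le]
    constructor <;> linarith
  have hL0 : 0 ≤ L / η := (abs_nonneg _).trans (h5 hne.some)
  have h9 : -(L / η * B) ≤ ∑ t ∈ Finset.Icc 1 m, ∑ i, a t i * u i := by
    rw [Finset.sum_comm]
    have : |∑ i, ∑ t ∈ Finset.Icc 1 m, a t i * u i| ≤ L / η * B := by
      refine (Finset.abs_sum_le_sum_abs _ _).trans ?_
      refine le_trans ?_ (mul_le_mul_of_nonneg_left hu hL0)
      rw [Finset.mul_sum]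
      refine Finset.sum_le_sum fun i _ => ?_
      rw [← Finset.sum_mul, abs_mul]
      exact mul_le_mul_of_nonneg_right (h5 i) (abs_nonneg _)
    exact (abs_le.1 this).1
  rw [Finset.sum_add_distrib, Finset.sum_neg_distrib, ← Finset.mul_sum, ← Finset.mul_sum] at hL
  have h10 : L / η * B = B * (Real.log (2 * d) / η) - (∑ t ∈ Finset.Icc 1 m, ∑ i, a t i * w t i)
      + B * η * ∑ t ∈ Finset.Icc 1 m, ∑ i,
        (p t i + n t i) / ((∑ j, |p t j|) + ∑ j, |n t j|) * (a t i) ^ 2 := by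
    rw [hL]; field_simp; ring
  linarith

lemma aelr_clip_abs {x c : ℝ} (hc : 0 < c) : |max (min x c) (-c)| ≤ c := by
  rw [abs_le]; exact ⟨le_max_right _ _, max_le (min_le_right _ _) (by linarith)⟩
lemma aelr_clip_sq {x c : ℝ} (hc : 0 < c) : (max (min x c) (-c)) ^ 2 ≤ x ^ 2 := by
  rw [sq_le_sq]
  rcases le_total x c with h | h
  · rcases le_total x (-c) with h' | h'
    · rw [min_eq_left h, max_eq_right h', abs_neg, abs_of_pos hc, abs_of_neg (by linarith)]; linarith
    · rw [min_eq_left h, max_eq_left h']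
  · rw [min_eq_right h, max_eq_left (by linarith), abs_of_pos hc, abs_of_pos (by linarith)]; exact h

lemma aelr_cond {Ω : Type*} {mΩ : MeasurableSpace Ω} (μ : Measure Ω) [IsProbabilityMeasure μ]
    (m' : MeasurableSpace Ω) (hm : m' ≤ mΩ) (q f : Ω → ℝ) (G : ℝ)
    (hq : StronglyMeasurable[m'] q) (hq0 : ∀ ω, 0 ≤ q ω) (hq1 : ∀ ω, q ω ≤ 1)
    (hf : Integrable f μ) (hb : ∀ᵐ ω ∂μ, |(μ[f | m']) ω| ≤ G) :
    Integrable (fun ω => q ω * f ω) μ ∧ (∫ ω, q ω * f ω ∂μ) ≤ ∫ ω, q ω * G ∂μ := by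
  have hqb : ∀ᵐ ω ∂μ, ‖q ω‖ ≤ 1 := ae_of_all _ fun ω => by
    rw [Real.norm_eq_abs, abs_of_nonneg (hq0 ω)]; exact hq1 ω
  have hI : Integrable (q * f) μ := hf.bdd_mul (hq.mono hm).aestronglyMeasurable hqb
  refine ⟨hI, ?_⟩
  have h1 := condExp_mul_of_stronglyMeasurable_left hq hI hf
  have h2 := integral_condExp (μ := μ) (f := q * f) hm
  change ∫ ω, (q * f) ω ∂μ ≤ _
  rw [← h2]
  refine integral_mono_ae integrable_condExp ?_ ?_
  · exact ((Integrable.of_bound (hq.mono hm).aestronglyMeasurable 1 hqb)).mul_const _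
  · filter_upwards [h1, hb] with ω h hb
    rw [h]
    exact mul_le_mul_of_nonneg_left ((le_abs_self _).trans hb) (hq0 ω)

/-- Risk bound for multiplicative weights on clipped stochastic gradients:
given a filtration `(F_t)` and random vectors `g̃_t` that are `F_t`-measurable with
`‖E[g̃_t² | F_{t-1}]‖_∞ ≤ G²` (entrywise square), set `ḡ_t[i] = clip(g̃_t[i], 1/η)`,
`z⁺_1 = z⁻_1 = 1_d`, `z⁺_{t+1}[i] = z⁺_t[i]·exp(-η ḡ_t[i])`, `z⁻_{t+1}[i] = z⁻_t[i]·exp(η ḡ_t[i])`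
and `w_t = B(z⁺_t - z⁻_t)/(‖z⁺_t‖₁ + ‖z⁻_t‖₁)`.  Then for every `‖w*‖₁ ≤ B`,
`E[Σ_t ḡ_t·w_t] ≤ E[Σ_t ḡ_t·w*] + B((log 2d)/η + η G² m)`. -/
theorem stmt10 (d m : ℕ) (hd : 1 ≤ d)
    {Ω : Type*} [mΩ : MeasurableSpace Ω] (μ : Measure Ω) [IsProbabilityMeasure μ]
    (F : Filtration ℕ mΩ)
    (B G η : ℝ) (hB : 0 < B) (hG : 0 < G) (hη : 0 < η)
    (g : ℕ → Ω → Fin d → ℝ)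
    (hgmeas : ∀ t ∈ Finset.Icc 1 m, StronglyMeasurable[F t] (g t))
    (hgsqint : ∀ t ∈ Finset.Icc 1 m, ∀ i, Integrable (fun ω => (g t ω i) ^ 2) μ)
    (hgvar : ∀ t ∈ Finset.Icc 1 m, ∀ i,
      ∀ᵐ ω ∂μ, |(μ[fun ω' => (g t ω' i) ^ 2 | F (t - 1)]) ω| ≤ G ^ 2)
    (gbar : ℕ → Ω → Fin d → ℝ)
    (hgbar : ∀ t ω i, gbar t ω i = clip (g t ω i) (1 / η))
    (zp zm : ℕ → Ω → Fin d → ℝ)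
    (hzp1 : ∀ ω i, zp 1 ω i = 1) (hzm1 : ∀ ω i, zm 1 ω i = 1)
    (hzp : ∀ t ∈ Finset.Icc 1 m, ∀ ω i,
      zp (t + 1) ω i = zp t ω i * Real.exp (-(η * gbar t ω i)))
    (hzm : ∀ t ∈ Finset.Icc 1 m, ∀ ω i,
      zm (t + 1) ω i = zm t ω i * Real.exp (η * gbar t ω i))
    (w : ℕ → Ω → Fin d → ℝ)
    (hw : ∀ t ω i, w t ω i =
      B * (zp t ω i - zm t ω i) / ((∑ j, |zp t ω j|) + ∑ j, |zm t ω j|))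
    (wstar : Fin d → ℝ) (hwstar : (∑ i, |wstar i|) ≤ B) :
    (∫ ω, ∑ t ∈ Finset.Icc 1 m, ∑ i, gbar t ω i * w t ω i ∂μ) ≤
      (∫ ω, ∑ t ∈ Finset.Icc 1 m, ∑ i, gbar t ω i * wstar i ∂μ) +
        B * (Real.log (2 * d) / η + η * G ^ 2 * m) := by
  have hc : 0 < 1 / η := by positivity
  have hne : Nonempty (Fin d) := ⟨⟨0, hd⟩⟩
  have hgb : ∀ t ω i, |gbar t ω i| ≤ 1 / η := fun t ω i => by
    rw [hgbar]; exact aelr_clip_abs hc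
  have hηg : ∀ t ω i, |η * gbar t ω i| ≤ 1 := fun t ω i => by
    rw [abs_mul, abs_of_pos hη]
    calc η * |gbar t ω i| ≤ η * (1 / η) := mul_le_mul_of_nonneg_left (hgb t ω i) hη.le
      _ = 1 := by field_simp
  have hgm : ∀ t ∈ Finset.Icc 1 m, ∀ i, Measurable[F t] (fun ω => gbar t ω i) := by
    intro t ht i
    have h1 : Measurable[F t] (fun ω => g t ω i) :=
      (measurable_pi_apply i).comp (hgmeas t ht).measurable
    simp only [hgbar, clip]
    exact (h1.min measurable_const).max measurable_const
  -- positivity and measurability of the weights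
  have hz : ∀ k, k ≤ m → (∀ ω i, 0 < zp (k + 1) ω i) ∧ (∀ ω i, 0 < zm (k + 1) ω i) ∧
      (∀ i, Measurable[F k] (fun ω => zp (k + 1) ω i)) ∧
      (∀ i, Measurable[F k] (fun ω => zm (k + 1) ω i)) := by
    intro k
    induction k with
    | zero =>
      intro _
      simp only [zero_add, hzp1, hzm1]
      exact ⟨fun _ _ => one_pos, fun _ _ => one_pos, fun _ => measurable_const,
        fun _ => measurable_const⟩
    | succ k ih =>
      intro hk
      obtain ⟨h1, h2, h3, h4⟩ := ih (by omega)
      have hm : k + 1 ∈ Finset.Icc 1 m := by simp; omega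
      have hle : F k ≤ F (k + 1) := F.mono (Nat.le_succ k)
      simp only [hzp _ hm, hzm _ hm]
      refine ⟨fun ω i => mul_pos (h1 ω i) (Real.exp_pos _),
        fun ω i => mul_pos (h2 ω i) (Real.exp_pos _), fun i => ?_, fun i => ?_⟩
      · exact ((h3 i).mono hle le_rfl).mul
          (Real.measurable_exp.comp ((hgm _ hm i).const_mul η).neg)
      · exact ((h4 i).mono hle le_rfl).mul
          (Real.measurable_exp.comp ((hgm _ hm i).const_mul η))
  have hz' : ∀ t ∈ Finset.Icc 1 m, (∀ ω i, 0 < zp t ω i) ∧ (∀ ω i, 0 < zm t ω i) ∧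
      (∀ i, Measurable[F (t - 1)] (fun ω => zp t ω i)) ∧
      (∀ i, Measurable[F (t - 1)] (fun ω => zm t ω i)) := by
    intro t ht
    rw [Finset.mem_Icc] at ht
    have := hz (t - 1) (by omega)
    rwa [Nat.sub_add_cancel ht.1] at this
  -- the total mass
  have hZm : ∀ t ∈ Finset.Icc 1 m, Measurable[F (t - 1)]
      (fun ω => (∑ j, |zp t ω j|) + ∑ j, |zm t ω j|) := by
    intro t ht
    obtain ⟨-, -, h3, h4⟩ := hz' t ht
    exact (Finset.measurable_fun_sum _ fun i _ => continuous_abs.measurable.comp (h3 i)).add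
      (Finset.measurable_fun_sum _ fun i _ => continuous_abs.measurable.comp (h4 i))
  have hZ : ∀ t ∈ Finset.Icc 1 m, ∀ ω, (∑ j, |zp t ω j|) + ∑ j, |zm t ω j| =
      ∑ i, (zp t ω i + zm t ω i) := by
    intro t ht ω
    obtain ⟨h1, h2, -, -⟩ := hz' t ht
    rw [Finset.sum_add_distrib]
    simp only [abs_of_pos (h1 _ _), abs_of_pos (h2 _ _)]
  have hZp : ∀ t ∈ Finset.Icc 1 m, ∀ ω, 0 < (∑ j, |zp t ω j|) + ∑ j, |zm t ω j| := by
    intro t ht ω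
    rw [hZ t ht]
    obtain ⟨h1, h2, -, -⟩ := hz' t ht
    exact Finset.sum_pos (fun i _ => add_pos (h1 ω i) (h2 ω i)) Finset.univ_nonempty
  set q : ℕ → Ω → Fin d → ℝ := fun t ω i =>
    (zp t ω i + zm t ω i) / ((∑ j, |zp t ω j|) + ∑ j, |zm t ω j|) with hq
  have hq0 : ∀ t ∈ Finset.Icc 1 m, ∀ ω i, 0 ≤ q t ω i := fun t ht ω i =>
    div_nonneg (add_pos ((hz' t ht).1 ω i) ((hz' t ht).2.1 ω i)).le (hZp t ht ω).le
  have hqs : ∀ t ∈ Finset.Icc 1 m, ∀ ω, ∑ i, q t ω i = 1 := by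
    intro t ht ω
    simp only [hq]
    rw [← Finset.sum_div, ← hZ t ht ω, div_self (hZp t ht ω).ne']
  have hq1 : ∀ t ∈ Finset.Icc 1 m, ∀ ω i, q t ω i ≤ 1 := by
    intro t ht ω i
    rw [← hqs t ht ω]
    exact Finset.single_le_sum (fun i _ => hq0 t ht ω i) (Finset.mem_univ i)
  have hqm : ∀ t ∈ Finset.Icc 1 m, ∀ i, Measurable[F (t - 1)] (fun ω => q t ω i) := by
    intro t ht i
    exact (((hz' t ht).2.2.1 i).add ((hz' t ht).2.2.2 i)).div (hZm t ht)
  have hgi : ∀ t ∈ Finset.Icc 1 m, ∀ i, Integrable (fun ω => gbar t ω i) μ := fun t ht i =>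
    Integrable.of_bound ((hgm t ht i).mono (F.le t) le_rfl).aestronglyMeasurable (1 / η)
      (ae_of_all _ fun ω => hgb t ω i)
  have hwm : ∀ t ∈ Finset.Icc 1 m, ∀ i, Measurable (fun ω => w t ω i) := by
    intro t ht i
    simp only [hw]
    exact (((((hz' t ht).2.2.1 i).sub ((hz' t ht).2.2.2 i)).const_mul B).div
      (hZm t ht)).mono (F.le _) le_rfl
  have hwb : ∀ t ∈ Finset.Icc 1 m, ∀ ω i, ‖w t ω i‖ ≤ B := by
    intro t ht ω i
    have h1 := (hz' t ht).1 ω i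
    have h2 := (hz' t ht).2.1 ω i
    have h3 := hq1 t ht ω i
    simp only [hq] at h3
    rw [div_le_one (hZp t ht ω)] at h3
    rw [hw, Real.norm_eq_abs, abs_div, abs_of_pos (hZp t ht ω), div_le_iff₀ (hZp t ht ω),
      abs_mul, abs_of_pos hB]
    refine mul_le_mul_of_nonneg_left (le_trans ?_ h3) hB.le
    rw [abs_le]; constructor <;> linarith
  have hI1 : Integrable (fun ω => ∑ t ∈ Finset.Icc 1 m, ∑ i, gbar t ω i * w t ω i) μ :=
    integrable_finsetSum _ fun t ht => integrable_finsetSum _ fun i _ =>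
      (hgi t ht i).mul_bdd (hwm t ht i).aestronglyMeasurable (ae_of_all _ fun ω => hwb t ht ω i)
  have hI2 : Integrable (fun ω => ∑ t ∈ Finset.Icc 1 m, ∑ i, gbar t ω i * wstar i) μ :=
    integrable_finsetSum _ fun t ht => integrable_finsetSum _ fun i _ =>
      (hgi t ht i).mul_const _
  have hC := fun t ht i => aelr_cond μ (F (t - 1)) (F.le _) (fun ω => q t ω i)
    (fun ω => (g t ω i) ^ 2) (G ^ 2) (hqm t ht i).stronglyMeasurable (fun ω => hq0 t ht ω i)
    (fun ω => hq1 t ht ω i) (hgsqint t ht i) (hgvar t ht i)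
  have hI3 : Integrable (fun ω => ∑ t ∈ Finset.Icc 1 m, ∑ i, q t ω i * (g t ω i) ^ 2) μ :=
    integrable_finsetSum _ fun t ht => integrable_finsetSum _ fun i _ => (hC t ht i).1
  have hV : ∫ ω, ∑ t ∈ Finset.Icc 1 m, ∑ i, q t ω i * (g t ω i) ^ 2 ∂μ ≤ G ^ 2 * m := by
    rw [integral_finsetSum _ fun t ht => integrable_finsetSum _ fun i _ => (hC t ht i).1]
    calc _ ≤ ∑ t ∈ Finset.Icc 1 m, G ^ 2 := by
          refine Finset.sum_le_sum fun t ht => ?_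
          rw [integral_finsetSum _ fun i _ => (hC t ht i).1]
          refine (Finset.sum_le_sum fun i _ => (hC t ht i).2).trans ?_
          rw [← integral_finsetSum]
          · simp only [← Finset.sum_mul, hqs t ht]
            simp
          · intro i _
            refine Integrable.mul_const (Integrable.of_bound
              ((hqm t ht i).mono (F.le _) le_rfl).aestronglyMeasurable 1
              (ae_of_all _ fun ω => ?_)) _
            rw [Real.norm_eq_abs, abs_of_nonneg (hq0 t ht ω i)]
            exact hq1 t ht ω i
      _ = G ^ 2 * m := by simp [mul_comm]
  have hpt : ∀ ω, (∑ t ∈ Finset.Icc 1 m, ∑ i, gbar t ω i * w t ω i) ≤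
      (∑ t ∈ Finset.Icc 1 m, ∑ i, gbar t ω i * wstar i) + B * (Real.log (2 * d) / η) +
      B * η * ∑ t ∈ Finset.Icc 1 m, ∑ i, q t ω i * (g t ω i) ^ 2 := by
    intro ω
    refine (aelr_det d m hd B η hB hη (fun t i => gbar t ω i) (fun t i => zp t ω i)
      (fun t i => zm t ω i) (fun t i => w t ω i) (fun t i => hηg t ω i) (hzp1 ω) (hzm1 ω)
      (fun t ht i => hzp t ht ω i) (fun t ht i => hzm t ht ω i) (fun t i => hw t ω i)
      wstar hwstar).trans ?_
    refine add_le_add le_rfl (mul_le_mul_of_nonneg_left ?_ (by positivity))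
    refine Finset.sum_le_sum fun t ht => Finset.sum_le_sum fun i _ => ?_
    refine mul_le_mul_of_nonneg_left ?_ (hq0 t ht ω i)
    rw [hgbar]; exact aelr_clip_sq hc
  have hI4 : Integrable (fun ω => (∑ t ∈ Finset.Icc 1 m, ∑ i, gbar t ω i * wstar i) +
      B * (Real.log (2 * d) / η)) μ := hI2.add (integrable_const _)
  calc _ ≤ ∫ ω, ((∑ t ∈ Finset.Icc 1 m, ∑ i, gbar t ω i * wstar i) +
        B * (Real.log (2 * d) / η) +
        B * η * ∑ t ∈ Finset.Icc 1 m, ∑ i, q t ω i * (g t ω i) ^ 2) ∂μ :=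
        integral_mono hI1 (hI4.add (hI3.const_mul _)) hpt
    _ = (∫ ω, ∑ t ∈ Finset.Icc 1 m, ∑ i, gbar t ω i * wstar i ∂μ) +
        B * (Real.log (2 * d) / η) +
        B * η * ∫ ω, ∑ t ∈ Finset.Icc 1 m, ∑ i, q t ω i * (g t ω i) ^ 2 ∂μ := by
        rw [integral_add hI4 (hI3.const_mul _),
          integral_add hI2 (integrable_const _)]
        congr 1
        · simp
        · exact integral_const_mul _ _
    _ ≤ _ := by
        have := mul_le_mul_of_nonneg_left hV (mul_pos hB hη).le
        linarith
end

section
/- Let B, G > 0 and 0 < η <= 1/(2G). Let (F_t)_{t=0..m} be a filtration, let g̃_1, ..., g̃_m be random vectors in R^d such that g̃_t is F_t-measurable and ||E[g̃_t^2 | F_{t-1}]||_∞ <= G^2 for all t (g̃_t^2 being the entrywise square), let ḡ_t[i] = clip(g̃_t[i], 1/η), and let w_1, ..., w_m be random vectors such that w_t is F_{t-1}-measurable with ||w_t||_1 <= B. Then E[Σ_{t=1}^m g̃_t · w_t] <= E[Σ_{t=1}^m ḡ_t · w_t] + 4 B η G^2 m. -/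
open MeasureTheory

theorem abs_sub_clip_le (x η : ℝ) (hη : 0 < η) : x - clip x (1 / η) ≤ η * x ^ 2 ∧
    -(x - clip x (1 / η)) ≤ η * x ^ 2 ∧ |clip x (1 / η)| ≤ 1 / η := by
  have hc : 0 < 1 / η := by positivity
  have hcη : 1 / η * η = 1 := by field_simp
  generalize 1 / η = c at hc hcη
  have h0 : 0 ≤ η * x ^ 2 := by positivity
  unfold clip
  rcases le_total x c with h1 | h1
  · rw [min_eq_left h1]
    rcases le_total x (-c) with h2 | h2
    · rw [max_eq_right h2, abs_neg, abs_of_pos hc]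
      refine ⟨by linarith, ?_, le_rfl⟩
      have : η * x ^ 2 = (η * (-x - c) + 1) * (-x) := by linear_combination (-x) * hcη
      nlinarith [mul_nonneg hη.le (by linarith : 0 ≤ -x - c),
        mul_nonneg (mul_nonneg hη.le (by linarith : 0 ≤ -x - c)) (by linarith : 0 ≤ -x)]
    · rw [max_eq_left h2]
      exact ⟨by linarith, by linarith, abs_le.2 ⟨h2, h1⟩⟩
  · rw [min_eq_right h1, max_eq_left (by linarith), abs_of_pos hc]
    refine ⟨?_, by linarith, le_rfl⟩
    have : η * x ^ 2 = (η * (x - c) + 1) * x := by linear_combination x * hcη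
    nlinarith [mul_nonneg hη.le (by linarith : 0 ≤ x - c),
        mul_nonneg (mul_nonneg hη.le (by linarith : 0 ≤ x - c)) (by linarith : 0 ≤ x)]

theorem clip_coord {Ω : Type*} (F : MeasurableSpace Ω) {m0 : MeasurableSpace Ω}
    (μ : Measure Ω) [IsProbabilityMeasure μ] (hF : F ≤ m0) (B G η : ℝ) (hη : 0 < η)
    (g w : Ω → ℝ) (hg : StronglyMeasurable g)
    (hg2 : Integrable (fun ω => (g ω) ^ 2) μ)
    (hv : ∀ᵐ ω ∂μ, |(μ[fun ω' => (g ω') ^ 2 | F]) ω| ≤ G ^ 2)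
    (hw : StronglyMeasurable[F] w) (hwB : ∀ ω, |w ω| ≤ B) :
    Integrable (fun ω => g ω * w ω) μ ∧ Integrable (fun ω => clip (g ω) (1 / η) * w ω) μ ∧
    Integrable (fun ω => |w ω|) μ ∧
    ∫ ω, g ω * w ω ∂μ ≤ ∫ ω, clip (g ω) (1 / η) * w ω ∂μ + η * G ^ 2 * ∫ ω, |w ω| ∂μ := by
  have hw0 : StronglyMeasurable w := hw.mono hF
  have hgi : Integrable g μ :=
    ((memLp_two_iff_integrable_sq hg.aestronglyMeasurable).2 hg2).integrable (by norm_num)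
  have hcm : StronglyMeasurable (fun ω => clip (g ω) (1 / η)) := by
    apply Measurable.stronglyMeasurable
    unfold clip
    exact (hg.measurable.min measurable_const).max measurable_const
  have hci : Integrable (fun ω => clip (g ω) (1 / η)) μ :=
    Integrable.of_bound hcm.aestronglyMeasurable (1 / η)
      (Filter.Eventually.of_forall fun ω => (abs_sub_clip_le (g ω) η hη).2.2)
  have hwi : Integrable w μ :=
    Integrable.of_bound hw0.aestronglyMeasurable B (Filter.Eventually.of_forall hwB)
  have h1 : Integrable (fun ω => g ω * w ω) μ :=
    hgi.mul_bdd (c := B) hw0.aestronglyMeasurable (Filter.Eventually.of_forall hwB)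
  have h2 : Integrable (fun ω => clip (g ω) (1 / η) * w ω) μ :=
    hci.mul_bdd (c := B) hw0.aestronglyMeasurable (Filter.Eventually.of_forall hwB)
  have hwa : StronglyMeasurable[F] (fun ω => |w ω|) := hw.norm
  have h3 : Integrable (fun ω => |w ω| * (g ω) ^ 2) μ :=
    hg2.bdd_mul (c := B) (hwa.mono hF).aestronglyMeasurable
      (Filter.Eventually.of_forall fun ω => by simpa using hwB ω)
  refine ⟨h1, h2, hwi.abs, ?_⟩
  have h4 : ∫ ω, |w ω| * (g ω) ^ 2 ∂μ ≤ G ^ 2 * ∫ ω, |w ω| ∂μ := by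
    rw [← integral_condExp hF, ← integral_const_mul]
    apply integral_mono_ae integrable_condExp (hwi.abs.const_mul _)
    have := condExp_mul_of_stronglyMeasurable_left (μ := μ) hwa h3 hg2
    filter_upwards [this, hv] with ω ha hb
    have ha' : (μ[fun ω => |w ω| * (g ω) ^ 2 | F]) ω
      = |w ω| * (μ[fun ω => (g ω) ^ 2 | F]) ω := ha
    rw [ha', mul_comm]
    exact mul_le_mul_of_nonneg_right ((le_abs_self _).trans hb) (abs_nonneg _)
  calc ∫ ω, g ω * w ω ∂μ
      ≤ ∫ ω, (clip (g ω) (1 / η) * w ω + η * (|w ω| * (g ω) ^ 2)) ∂μ := by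
        apply integral_mono h1 (h2.add (h3.const_mul η))
        intro ω
        obtain ⟨ha, hb, -⟩ := abs_sub_clip_le (g ω) η hη
        have hab : |g ω - clip (g ω) (1 / η)| ≤ η * (g ω) ^ 2 := abs_le'.2 ⟨ha, hb⟩
        have := mul_le_mul_of_nonneg_right hab (abs_nonneg (w ω))
        rw [← abs_mul] at this
        have h5 := (le_abs_self _).trans this
        simp only [Pi.add_apply]
        linarith
    _ = ∫ ω, clip (g ω) (1 / η) * w ω ∂μ + η * ∫ ω, |w ω| * (g ω) ^ 2 ∂μ := by
        rw [integral_add h2 (h3.const_mul η), integral_const_mul]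
    _ ≤ _ := by
        have := mul_le_mul_of_nonneg_left h4 hη.le
        linarith

/-- Clipping changes the risk by at most `4BηG²m`: given a filtration
`(F_t)`, random vectors `g̃_t` that are `F_t`-measurable with `‖E[g̃_t² | F_{t-1}]‖_∞ ≤ G²`
(entrywise square), `ḡ_t[i] = clip(g̃_t[i], 1/η)` with `0 < η ≤ 1/(2G)`, and `F_{t-1}`-measurable
`w_t` with `‖w_t‖₁ ≤ B`, one has
`E[Σ_t g̃_t·w_t] ≤ E[Σ_t ḡ_t·w_t] + 4BηG²m`. -/
theorem stmt11 (d m : ℕ)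
    {Ω : Type*} [mΩ : MeasurableSpace Ω] (μ : Measure Ω) [IsProbabilityMeasure μ]
    (F : Filtration ℕ mΩ)
    (B G η : ℝ) (hB : 0 < B) (hG : 0 < G) (hη : 0 < η) (hη2 : η ≤ 1 / (2 * G))
    (g : ℕ → Ω → Fin d → ℝ)
    (hgmeas : ∀ t ∈ Finset.Icc 1 m, StronglyMeasurable[F t] (g t))
    (hgsqint : ∀ t ∈ Finset.Icc 1 m, ∀ i, Integrable (fun ω => (g t ω i) ^ 2) μ)
    (hgvar : ∀ t ∈ Finset.Icc 1 m, ∀ i,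
      ∀ᵐ ω ∂μ, |(μ[fun ω' => (g t ω' i) ^ 2 | F (t - 1)]) ω| ≤ G ^ 2)
    (gbar : ℕ → Ω → Fin d → ℝ)
    (hgbar : ∀ t ω i, gbar t ω i = clip (g t ω i) (1 / η))
    (w : ℕ → Ω → Fin d → ℝ)
    (hwmeas : ∀ t ∈ Finset.Icc 1 m, StronglyMeasurable[F (t - 1)] (w t))
    (hwB : ∀ t ∈ Finset.Icc 1 m, ∀ ω, (∑ i, |w t ω i|) ≤ B) :
    (∫ ω, ∑ t ∈ Finset.Icc 1 m, ∑ i, g t ω i * w t ω i ∂μ) ≤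
      (∫ ω, ∑ t ∈ Finset.Icc 1 m, ∑ i, gbar t ω i * w t ω i ∂μ) +
        4 * B * η * G ^ 2 * m := by
  have key : ∀ t ∈ Finset.Icc 1 m, ∀ i, _ := fun t ht i =>
    clip_coord (F (t - 1)) μ (F.le _) B G η hη (fun ω => g t ω i) (fun ω => w t ω i)
      ((((continuous_apply i).comp_stronglyMeasurable (hgmeas t ht))).mono (F.le t))
      (hgsqint t ht i) (hgvar t ht i)
      ((continuous_apply i).comp_stronglyMeasurable (hwmeas t ht))
      (fun ω => (Finset.single_le_sum (f := fun i => |w t ω i|)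
        (fun j _ => abs_nonneg _) (Finset.mem_univ i)).trans (hwB t ht ω))
  simp only [hgbar]
  rw [integral_finsetSum _ fun t ht => integrable_finsetSum _ fun i _ => (key t ht i).1,
    integral_finsetSum _ fun t ht => integrable_finsetSum _ fun i _ => (key t ht i).2.1]
  have hm : 4 * B * η * G ^ 2 * m = ∑ t ∈ Finset.Icc 1 m, 4 * B * η * G ^ 2 := by
    simp; ring
  rw [hm, ← Finset.sum_add_distrib]
  apply Finset.sum_le_sum
  intro t ht
  rw [integral_finsetSum _ fun i _ => (key t ht i).1,
    integral_finsetSum _ fun i _ => (key t ht i).2.1]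
  have h1 := Finset.sum_le_sum fun i (_ : i ∈ Finset.univ) => (key t ht i).2.2.2
  rw [Finset.sum_add_distrib, ← Finset.mul_sum,
    ← integral_finsetSum _ fun i _ => (key t ht i).2.2.1] at h1
  have h2 : ∫ ω, ∑ i, |w t ω i| ∂μ ≤ B := by
    have := integral_mono (μ := μ)
      (integrable_finsetSum _ fun i _ => (key t ht i).2.2.1) (integrable_const B) (hwB t ht)
    simpa using this
  have h3 := mul_le_mul_of_nonneg_left h2 (by positivity : 0 ≤ η * G ^ 2)
  have h4 : 0 ≤ η * G ^ 2 * B := by positivity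
  linarith
end

section
/- Fix integers 1 <= k <= d and B > 0. Let w in R^d with w ≠ 0 and ||w||_1 <= B, let x in R^d with ||x||_∞ <= 1, and let y in R with |y| <= B. Let g̃ = θ̃ · x̃ be the Lasso gradient estimator. Then E[g̃] = (w·x - y) · x, and ||E[g̃^2]||_∞ <= 8 B^2 d / k, where g̃^2 denotes the entrywise square of g̃. -/
open MeasureTheory
open scoped ENNReal

/-- The sparse attribute estimator `x̃ = (1/k) Σ_{r=1}^k d · x[i_r] · e_{i_r}`, written
coordinatewise. -/
noncomputable def xTilPi (d k : ℕ) (x : Fin d → ℝ) (ir : Fin k → Fin d) : Fin d → ℝ :=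
  fun i => (k : ℝ)⁻¹ * ∑ r : Fin k, if ir r = i then (d : ℝ) * x (ir r) else 0

/-- The importance-sampling distribution on `{1,…,d}` with `P[j = i] = |w[i]|/‖w‖₁`. -/
noncomputable def lassoJMeasure (d : ℕ) (w : Fin d → ℝ) : Measure (Fin d) :=
  Measure.sum fun i => ENNReal.ofReal (|w i| / ∑ j, |w j|) • Measure.dirac i

/-- The Lasso residual estimator `θ̃ = ‖w‖₁·sign(w[j])·x[j] - y`. -/
noncomputable def lassoThetaTil (d : ℕ) (w x : Fin d → ℝ) (y : ℝ) (j : Fin d) : ℝ :=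
  (∑ i, |w i|) * Real.sign (w j) * x j - y

/-- The Lasso gradient estimator `g̃ = θ̃ · x̃`. -/
noncomputable def lassoGTil (d k : ℕ) (w x : Fin d → ℝ) (y : ℝ)
    (ir : Fin k → Fin d) (j : Fin d) : Fin d → ℝ :=
  fun i => lassoThetaTil d w x y j * xTilPi d k x ir i


theorem sum_ind_prod (d k : ℕ) (i : Fin d) (S : Finset (Fin k)) :
    (∑ ir : Fin k → Fin d, ∏ t ∈ S, (if ir t = i then (1 : ℝ) else 0)) * (d : ℝ) ^ S.card
      = (d : ℝ) ^ k := by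
  have h1 : ∀ ir : Fin k → Fin d, ∏ t ∈ S, (if ir t = i then (1 : ℝ) else 0)
      = ∏ t, (fun t a => if t ∈ S then (if a = i then (1 : ℝ) else 0) else 1) t (ir t) := by
    intro ir
    simp only [Finset.prod_ite_mem, Finset.univ_inter]
  rw [Finset.sum_congr rfl (fun ir _ => h1 ir), ← Fintype.piFinset_univ,
    ← Finset.prod_univ_sum (fun _ : Fin k => (Finset.univ : Finset (Fin d)))
      (fun t a => if t ∈ S then (if a = i then (1 : ℝ) else 0) else 1)]
  have h2 : ∀ t : Fin k, (∑ a : Fin d, if t ∈ S then (if a = i then (1 : ℝ) else 0) else 1)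
      = if t ∈ S then 1 else (d : ℝ) := by
    intro t
    split_ifs <;> simp
  have h3 : (d : ℝ) ^ S.card = ∏ t : Fin k, if t ∈ S then (d : ℝ) else 1 := by
    rw [Finset.prod_ite_mem, Finset.univ_inter, Finset.prod_const]
  simp only [h2]
  rw [h3, ← Finset.prod_mul_distrib]
  have h4 : ∀ t : Fin k, ((if t ∈ S then 1 else (d : ℝ)) * if t ∈ S then (d : ℝ) else 1) = d := by
    intro t
    split_ifs <;> simp
  simp [h4]

theorem sum_ind_one (d k : ℕ) (i : Fin d) (r : Fin k) :
    (∑ ir : Fin k → Fin d, (if ir r = i then (1 : ℝ) else 0)) = (d : ℝ) ^ k / d := by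
  have hd : (d : ℝ) ≠ 0 := by
    have := i.pos
    positivity
  have := sum_ind_prod d k i {r}
  simp only [Finset.prod_singleton, Finset.card_singleton, pow_one] at this
  rw [eq_div_iff hd, this]

theorem sum_ind_two (d k : ℕ) (i : Fin d) (r s : Fin k) (h : r ≠ s) :
    (∑ ir : Fin k → Fin d, (if ir r = i then (1 : ℝ) else 0) * (if ir s = i then (1 : ℝ) else 0))
      = (d : ℝ) ^ k / d ^ 2 := by
  have hd : (d : ℝ) ≠ 0 := by
    have := i.pos
    positivity
  have := sum_ind_prod d k i {r, s}
  simp only [Finset.prod_pair h, Finset.card_pair h] at this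
  rw [eq_div_iff (pow_ne_zero _ hd), this]

theorem xTil_eq (d k : ℕ) (x : Fin d → ℝ) (ir : Fin k → Fin d) (i : Fin d) :
    xTilPi d k x ir i = (k : ℝ)⁻¹ * (d * x i) * ∑ r : Fin k, if ir r = i then (1 : ℝ) else 0 := by
  unfold xTilPi
  rw [mul_assoc]
  congr 1
  rw [Finset.mul_sum]
  refine Finset.sum_congr rfl fun r _ => ?_
  split_ifs with h
  · rw [h, mul_one]
  · simp

theorem integral_uniformM {α : Type*} [Fintype α] [MeasurableSpace α]
    [MeasurableSingletonClass α] (f : α → ℝ) :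
    ∫ a, f a ∂(uniformM α) = (Fintype.card α : ℝ)⁻¹ * ∑ a, f a := by
  unfold uniformM
  rw [integral_smul_measure, integral_fintype (Integrable.of_finite)]
  simp [Measure.real]

theorem lassoJ_fin (d : ℕ) (w : Fin d → ℝ) : IsFiniteMeasure (lassoJMeasure d w) := by
  constructor
  unfold lassoJMeasure
  rw [Measure.sum_apply _ MeasurableSet.univ, tsum_fintype]
  simp

theorem uniformM_fin {α : Type*} [Fintype α] [Nonempty α] [MeasurableSpace α] :
    IsFiniteMeasure (uniformM α) := by
  unfold uniformM
  constructor
  have : (Fintype.card α : ℝ≥0∞) ≠ 0 := by simp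
  simp only [Measure.smul_apply, smul_eq_mul]
  exact ENNReal.mul_lt_top (by simpa using this.bot_lt) (measure_lt_top _ _)

theorem integral_lassoJ (d : ℕ) (w : Fin d → ℝ) (f : Fin d → ℝ) :
    ∫ j, f j ∂(lassoJMeasure d w) = ∑ j, |w j| / (∑ i, |w i|) * f j := by
  unfold lassoJMeasure
  rw [Measure.sum_fintype, integral_finsetSum_measure (fun i _ =>
    (integrable_dirac (by simp)).smul_measure ENNReal.ofReal_ne_top)]
  refine Finset.sum_congr rfl fun j _ => ?_
  rw [integral_smul_measure, integral_dirac, ENNReal.toReal_ofReal (by positivity), smul_eq_mul]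

theorem mean_x (d k : ℕ) (hk1 : 1 ≤ k) (x : Fin d → ℝ) (i : Fin d) :
    ∫ ir, xTilPi d k x ir i ∂(uniformM (Fin k → Fin d)) = x i := by
  have hd : (d : ℝ) ≠ 0 := by
    have := i.pos
    positivity
  have hk : (k : ℝ) ≠ 0 := by positivity
  rw [integral_uniformM]
  simp_rw [xTil_eq]
  rw [← Finset.mul_sum, Finset.sum_comm]
  simp_rw [sum_ind_one]
  simp
  field_simp

theorem sq_x (d k : ℕ) (hk1 : 1 ≤ k) (hkd : k ≤ d) (x : Fin d → ℝ) (hx : ∀ i, |x i| ≤ 1)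
    (i : Fin d) :
    ∫ ir, (xTilPi d k x ir i) ^ 2 ∂(uniformM (Fin k → Fin d)) ≤ 2 * d / k := by
  have hd : (0 : ℝ) < d := by
    have := i.pos
    positivity
  have hk : (0 : ℝ) < k := by positivity
  have hkd' : (k : ℝ) ≤ d := by exact_mod_cast hkd
  rw [integral_uniformM]
  simp_rw [xTil_eq, mul_pow _ (Finset.sum _ _)]
  rw [← Finset.mul_sum]
  simp_rw [sq (Finset.sum _ _), Finset.sum_mul_sum]
  rw [Finset.sum_comm]
  have key : ∀ r : Fin k, (∑ ir : Fin k → Fin d, ∑ s : Fin k,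
      (if ir r = i then (1 : ℝ) else 0) * (if ir s = i then (1 : ℝ) else 0))
      ≤ 2 * (d : ℝ) ^ k / d := by
    intro r
    rw [Finset.sum_comm]
    calc _ ≤ ∑ s : Fin k, ((if s = r then (d : ℝ) ^ k / d else 0) + (d : ℝ) ^ k / d ^ 2) := by
          refine Finset.sum_le_sum fun s _ => ?_
          split_ifs with h
          · subst h
            rw [← sum_ind_one d k i s]
            have : 0 ≤ (d : ℝ) ^ k / d ^ 2 := by positivity
            simp only [mul_ite, mul_one, mul_zero, ite_self]
            refine le_add_of_le_of_nonneg (le_of_eq ?_) this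
            refine Finset.sum_congr rfl fun ir _ => ?_
            split_ifs <;> rfl
          · rw [sum_ind_two d k i r s (Ne.symm h), zero_add]
      _ = (d : ℝ) ^ k / d + k * ((d : ℝ) ^ k / d ^ 2) := by
          rw [Finset.sum_add_distrib]; simp
      _ ≤ (d : ℝ) ^ k / d + d * ((d : ℝ) ^ k / d ^ 2) := by gcongr
      _ = _ := by field_simp; ring
  have hx2 : x i ^ 2 ≤ 1 := by
    rw [← sq_abs]
    exact pow_le_one₀ (abs_nonneg _) (hx i)
  have key2 := Finset.sum_le_sum (fun r (_ : r ∈ (Finset.univ : Finset (Fin k))) => key r)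
  rw [Finset.sum_const, Finset.card_univ, Fintype.card_fin, nsmul_eq_mul] at key2
  calc _ ≤ ((Fintype.card (Fin k → Fin d) : ℝ))⁻¹ *
        (((k : ℝ)⁻¹ * (d * x i)) ^ 2 * (k * (2 * (d : ℝ) ^ k / d))) := by gcongr
    _ = 2 * d / k * x i ^ 2 := by
        simp
        field_simp
    _ ≤ 2 * d / k * 1 := by gcongr
    _ = _ := mul_one _

theorem l1_pos (d : ℕ) (w : Fin d → ℝ) (hw0 : w ≠ 0) : 0 < ∑ i, |w i| := by
  obtain ⟨j, hj⟩ := Function.ne_iff.mp hw0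
  exact Finset.sum_pos' (fun i _ => abs_nonneg _) ⟨j, Finset.mem_univ _, abs_pos.mpr hj⟩

theorem mean_theta (d : ℕ) (w x : Fin d → ℝ) (hw0 : w ≠ 0) (y : ℝ) :
    ∫ j, lassoThetaTil d w x y j ∂(lassoJMeasure d w) = (∑ i, w i * x i) - y := by
  have h := l1_pos d w hw0
  rw [integral_lassoJ]
  unfold lassoThetaTil
  simp_rw [mul_sub]
  rw [Finset.sum_sub_distrib, ← Finset.sum_mul, ← Finset.sum_div, div_self h.ne', one_mul]
  congr 1
  refine Finset.sum_congr rfl fun j _ => ?_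
  have : |w j| * Real.sign (w j) = w j := by
    rcases lt_trichotomy (w j) 0 with h | h | h
    · rw [Real.sign_of_neg h, abs_of_neg h]; ring
    · simp [h]
    · rw [Real.sign_of_pos h, abs_of_pos h]; ring
  conv_rhs => rw [← this]
  field_simp

theorem sq_theta (d : ℕ) (B : ℝ) (w x : Fin d → ℝ) (hw0 : w ≠ 0) (hwB : (∑ i, |w i|) ≤ B)
    (hx : ∀ i, |x i| ≤ 1) (y : ℝ) (hy : |y| ≤ B) :
    ∫ j, (lassoThetaTil d w x y j) ^ 2 ∂(lassoJMeasure d w) ≤ 4 * B ^ 2 := by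
  have h := l1_pos d w hw0
  rw [integral_lassoJ]
  calc _ ≤ ∑ j, |w j| / (∑ i, |w i|) * (4 * B ^ 2) := by
        refine Finset.sum_le_sum fun j _ => ?_
        have hs : |Real.sign (w j)| ≤ 1 := by
          rcases Real.sign_apply_eq (w j) with h | h | h <;> simp [h]
        have h1 : |lassoThetaTil d w x y j| ≤ 2 * B := by
          unfold lassoThetaTil
          refine (abs_sub _ _).trans ?_
          rw [abs_mul, abs_mul, abs_of_pos h]
          have : (∑ i, |w i|) * |Real.sign (w j)| * |x j| ≤ B * 1 * 1 := by
            have := hx j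
            have hB0 : 0 ≤ B := h.le.trans hwB
            gcongr
          linarith
        have h2 : (lassoThetaTil d w x y j) ^ 2 ≤ 4 * B ^ 2 := by
          have := sq_le_sq' (abs_le.mp h1).1 (abs_le.mp h1).2
          linarith
        gcongr
    _ = _ := by rw [← Finset.sum_mul, ← Finset.sum_div, div_self h.ne', one_mul]

/-- The Lasso gradient estimator `g̃ = θ̃·x̃`, where `x̃` is built from `k`
i.i.d. uniform attribute samples and `θ̃` from an independent importance sample `j` with
`P[j = i] = |w[i]|/‖w‖₁`, satisfies `E[g̃] = (w·x - y)·x` and `‖E[g̃²]‖_∞ ≤ 8B²d/k` (entrywise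
square), whenever `w ≠ 0`, `‖w‖₁ ≤ B`, `‖x‖_∞ ≤ 1`, `|y| ≤ B` and `1 ≤ k ≤ d`. -/
theorem stmt12 (d k : ℕ) (hk1 : 1 ≤ k) (hkd : k ≤ d) (B : ℝ) (hB : 0 < B)
    (w x : Fin d → ℝ) (hw0 : w ≠ 0) (hwB : (∑ i, |w i|) ≤ B)
    (hx : ∀ i, |x i| ≤ 1) (y : ℝ) (hy : |y| ≤ B) :
    (∫ q : (Fin k → Fin d) × Fin d, lassoGTil d k w x y q.1 q.2
        ∂(uniformM (Fin k → Fin d)).prod (lassoJMeasure d w)) =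
        ((∑ i, w i * x i) - y) • x ∧
      ∀ i : Fin d,
        (∫ q : (Fin k → Fin d) × Fin d, (lassoGTil d k w x y q.1 q.2 i) ^ 2
            ∂(uniformM (Fin k → Fin d)).prod (lassoJMeasure d w)) ≤
          8 * B ^ 2 * d / k := by
  have hd : 0 < d := by omega
  haveI : NeZero d := ⟨hd.ne'⟩
  haveI := lassoJ_fin d w
  haveI : IsFiniteMeasure (uniformM (Fin k → Fin d)) := uniformM_fin
  constructor
  · funext i
    rw [eval_integral (fun i => Integrable.of_finite)]
    simp only [lassoGTil]
    simp_rw [mul_comm (lassoThetaTil _ _ _ _ _)]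
    rw [integral_prod_mul (fun ir => xTilPi d k x ir i) (fun j => lassoThetaTil d w x y j),
      mean_x d k hk1, mean_theta d w x hw0]
    simp [mul_comm]
  · intro i
    simp only [lassoGTil]
    simp_rw [mul_comm (lassoThetaTil _ _ _ _ _), mul_pow]
    rw [integral_prod_mul (fun ir => xTilPi d k x ir i ^ 2)
      (fun j => lassoThetaTil d w x y j ^ 2)]
    calc _ ≤ (2 * d / k : ℝ) * (4 * B ^ 2) := by
          refine mul_le_mul (sq_x d k hk1 hkd x hx i) (sq_theta d B w x hw0 hwB hx y hy)
            (integral_nonneg fun j => sq_nonneg _) (by positivity)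
      _ = _ := by ring
end

section
/- Let X be a real random variable with E[X^2] < ∞, let C > 0, and suppose |E[X]| <= C/2. Let X̄ = clip(X, C) = max(min(X, C), -C). Then |E[X̄] - E[X]| <= 2 Var[X] / C. -/
open MeasureTheory

/-- Bias of clipping in terms of the variance: if `X` is a real random
variable with `E[X²] < ∞` and `|E[X]| ≤ C/2` for some `C > 0`, then the clipped variable
`X̄ = clip(X, C) = max(min(X, C), -C)` satisfies `|E[X̄] - E[X]| ≤ 2 Var[X]/C`. -/
theorem stmt13 {Ω : Type*} [MeasurableSpace Ω] (μ : Measure Ω) [IsProbabilityMeasure μ]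
    (X : Ω → ℝ) (hXmeas : Measurable X)
    (hX2 : Integrable (fun ω => X ω ^ 2) μ)
    (C : ℝ) (hC : 0 < C) (hEX : |∫ ω, X ω ∂μ| ≤ C / 2) :
    |(∫ ω, max (min (X ω) C) (-C) ∂μ) - ∫ ω, X ω ∂μ| ≤
      2 * ProbabilityTheory.variance X μ / C := by
  have hL2 : MemLp X 2 μ := (memLp_two_iff_integrable_sq hXmeas.aestronglyMeasurable).2 hX2
  have hX : Integrable X μ := hL2.integrable (by norm_num)
  have hcl : Integrable (fun ω => max (min (X ω) C) (-C)) μ :=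
    (hX.inf (integrable_const C)).sup (integrable_const (-C))
  rw [ProbabilityTheory.variance_eq_integral hXmeas.aemeasurable, ← integral_sub hcl hX]
  set m := ∫ ω, X ω ∂μ with hm
  have hsq : Integrable (fun ω => (X ω - m) ^ 2) μ :=
    (hL2.sub (memLp_const m)).integrable_sq
  rw [mul_div_right_comm, ← integral_const_mul]
  refine abs_integral_le_integral_abs.trans ?_
  refine integral_mono (hcl.sub hX).abs (hsq.const_mul _) fun ω => ?_
  obtain ⟨h1, h2⟩ := abs_le.1 hEX
  change |max (min (X ω) C) (-C) - X ω| ≤ 2 / C * (X ω - m) ^ 2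
  generalize X ω = x
  rw [div_mul_eq_mul_div, le_div_iff₀ hC]
  rcases le_total x C with h | h
  · rw [min_eq_left h]
    rcases le_total x (-C) with h' | h'
    · rw [max_eq_right h', abs_of_nonneg (by linarith)]
      have h3 : (-x - C / 2) ^ 2 ≤ (m - x) ^ 2 :=
        pow_le_pow_left₀ (by linarith) (by linarith) 2
      nlinarith [sq_nonneg (-C - x), mul_nonneg (sub_nonneg.2 h') hC.le]
    · rw [max_eq_left h', sub_self, abs_zero, zero_mul]
      positivity
  · rw [min_eq_right h, max_eq_left (by linarith), abs_of_nonpos (by linarith)]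
    have h3 : (x - C / 2) ^ 2 ≤ (x - m) ^ 2 :=
      pow_le_pow_left₀ (by linarith) (by linarith) 2
    nlinarith [sq_nonneg (x - C), mul_nonneg (sub_nonneg.2 h) hC.le]
end

section
/- For every real N >= 1, setting ν = 2 log_2 N, it holds that Σ_{n >= 0, n <= ν} n · 2^{-(n+1)} + N · Σ_{n >= 0, n > ν} n · 2^{-(n+1)} <= 3. -/
lemma aux_partial (r : ℕ) :
    ∑ n ∈ Finset.range r, (n : ℝ) / 2 ^ (n + 1) = 1 - (r + 1) / 2 ^ r := by
  induction r with
  | zero => simp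
  | succ k ih =>
    rw [Finset.sum_range_succ, ih]
    push_cast
    field_simp
    ring

lemma aux_total : HasSum (fun n : ℕ => (n : ℝ) / 2 ^ (n + 1)) 1 := by
  have h := (hasSum_coe_mul_geometric_of_norm_lt_one (𝕜 := ℝ) (r := 1 / 2)
    (by norm_num)).mul_left (1 / 2)
  convert h using 1
  · rfl
  · funext n
    rw [div_pow, one_pow, pow_succ]
    field_simp
  · norm_num

lemma aux_sq (r : ℕ) : ((r : ℝ) + 1) ^ 2 ≤ 4 * 2 ^ r := by
  rcases Nat.lt_or_ge r 2 with h | h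
  · interval_cases r <;> norm_num
  · induction r, h using Nat.le_induction with
    | base => norm_num
    | succ k hk ih =>
      have : (2 : ℝ) ≤ k := by exact_mod_cast hk
      rw [pow_succ (2 : ℝ) k]
      push_cast
      nlinarith

/-- Expected number of attribute queries of the `GenEst` procedure:
for every real `N ≥ 1`, with `ν = 2 log₂ N`,
`Σ_{n ≤ ν} n·2^{-(n+1)} + N · Σ_{n > ν} n·2^{-(n+1)} ≤ 3`. -/
theorem stmt15 (N : ℝ) (hN : 1 ≤ N) :
    (∑' n : ℕ, if (n : ℝ) ≤ 2 * Real.logb 2 N then (n : ℝ) / 2 ^ (n + 1) else 0) +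
      N * ∑' n : ℕ, (if 2 * Real.logb 2 N < (n : ℝ) then (n : ℝ) / 2 ^ (n + 1) else 0) ≤ 3 := by
  have hN0 : 0 < N := by linarith
  have hlog : 0 ≤ Real.logb 2 N := Real.logb_nonneg (by norm_num) hN
  set v := 2 * Real.logb 2 N with hv
  have hv0 : 0 ≤ v := by positivity
  obtain ⟨r, hr⟩ : ∃ r, r = ⌊v⌋₊ + 1 := ⟨_, rfl⟩
  have hle : ∀ n : ℕ, (n : ℝ) ≤ v ↔ n < r := by
    intro n
    rw [hr, Nat.lt_succ_iff, Nat.le_floor_iff hv0]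
  have hA : HasSum (fun n : ℕ => if (n : ℝ) ≤ v then (n : ℝ) / 2 ^ (n + 1) else 0)
      (1 - ((r : ℝ) + 1) / 2 ^ r) := by
    rw [← aux_partial]
    have h := hasSum_sum_of_ne_finset_zero (L := SummationFilter.unconditional ℕ) (s := Finset.range r)
      (f := fun n : ℕ => if (n : ℝ) ≤ v then (n : ℝ) / 2 ^ (n + 1) else 0)
      (by
        intro n hn
        rw [Finset.mem_range, ← hle] at hn
        simp only [if_neg hn])
    convert h using 1
    apply Finset.sum_congr rfl
    intro n hn
    rw [Finset.mem_range, ← hle] at hn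
    rw [if_pos hn]
  have hB : HasSum (fun n : ℕ => if v < (n : ℝ) then (n : ℝ) / 2 ^ (n + 1) else 0)
      (((r : ℝ) + 1) / 2 ^ r) := by
    convert aux_total.sub hA using 1
    · rfl
    · funext n
      by_cases h : (n : ℝ) ≤ v
      · simp [h, not_lt.mpr h]
      · simp [h, not_le.mp h]
    · ring
  rw [hA.tsum_eq, hB.tsum_eq]
  have hvr : v < r := by
    rw [← not_le, hle]
    exact lt_irrefl r
  have hN2 : N ^ 2 ≤ 2 ^ r := by
    have h1 : Real.logb 2 (N ^ 2) < r := by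
      rw [Real.logb_pow]
      exact_mod_cast hvr
    rw [Real.logb_lt_iff_lt_rpow (by norm_num) (by positivity), Real.rpow_natCast] at h1
    exact h1.le
  have hp : (0 : ℝ) < 2 ^ r := by positivity
  have hkey : N * ((r : ℝ) + 1) ≤ 2 * 2 ^ r := by
    refine abs_le_of_sq_le_sq' ?_ (by positivity) |>.2
    calc (N * ((r : ℝ) + 1)) ^ 2 = N ^ 2 * ((r : ℝ) + 1) ^ 2 := by ring
      _ ≤ 2 ^ r * (4 * 2 ^ r) := by
        gcongr
        exact aux_sq r
      _ = (2 * 2 ^ r) ^ 2 := by ring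
  have h3 : N * (((r : ℝ) + 1) / 2 ^ r) ≤ 2 := by
    rw [← mul_div_assoc, div_le_iff₀ hp]
    exact hkey
  have h4 : 0 ≤ ((r : ℝ) + 1) / 2 ^ r := by positivity
  linarith
end

section
/- Let ε > 0 and δ >= 0. Define erf(x) = (2/sqrt(π)) ∫_0^x e^{-t^2} dt, ρ(x) = x · erf(x) + e^{-x^2}/sqrt(π), f_ε(x) = (ε/2) ρ((x-δ)/ε) + (ε/2) ρ((x+δ)/ε) - δ, and |x|_δ = max(0, |x| - δ). Then f_ε is convex on R, f_ε is real-analytic on all of R, and sup_{x in R} |f_ε(x) - |x|_δ| <= ε. -/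
/-- The Gauss error function `erf(x) = (2/√π) ∫_0^x e^{-t²} dt`. -/
noncomputable def erf (x : ℝ) : ℝ :=
  (2 / Real.sqrt Real.pi) * ∫ t in (0 : ℝ)..x, Real.exp (-t ^ 2)

/-- `ρ(x) = x·erf(x) + e^{-x²}/√π`, the smooth approximation of the absolute value. -/
noncomputable def rho (x : ℝ) : ℝ :=
  x * erf x + Real.exp (-x ^ 2) / Real.sqrt Real.pi

/-- The smooth analytic approximation `f_ε` of the `δ`-insensitive absolute loss:
`f_ε(x) = (ε/2)ρ((x-δ)/ε) + (ε/2)ρ((x+δ)/ε) - δ`. -/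
noncomputable def feps (ε δ : ℝ) (x : ℝ) : ℝ :=
  ε / 2 * rho ((x - δ) / ε) + ε / 2 * rho ((x + δ) / ε) - δ

open MeasureTheory Set Filter Topology in
lemma rho_bound_nonneg (x : ℝ) (hx : 0 ≤ x) : 0 ≤ rho x - x ∧ rho x - x ≤ 1 := by
  have hint : Integrable (fun t : ℝ => Real.exp (-t ^ 2)) := by
    simpa using integrable_exp_neg_mul_sq (b := 1) one_pos
  have hint2 : Integrable (fun t : ℝ => t * Real.exp (-t ^ 2)) := by
    simpa using integrable_mul_exp_neg_mul_sq (b := 1) one_pos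
  have hG : ∫ t in Ioi (0 : ℝ), Real.exp (-t ^ 2) = Real.sqrt Real.pi / 2 := by
    simpa using integral_gaussian_Ioi 1
  have hsplit := intervalIntegral.integral_interval_add_Ioi (a := 0) (b := x)
    hint.integrableOn hint.integrableOn
  rw [hG] at hsplit
  have hJ0 : 0 ≤ ∫ t in Ioi x, Real.exp (-t ^ 2) :=
    integral_nonneg fun t => (Real.exp_pos _).le
  have hK : ∫ t in Ioi x, t * Real.exp (-t ^ 2) = 0 - (-(Real.exp (-x ^ 2) / 2)) := by
    refine integral_Ioi_of_hasDerivAt_of_tendsto'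
      (f := fun t => -(Real.exp (-t ^ 2) / 2)) (fun t _ => ?_) hint2.integrableOn ?_
    · have := ((((hasDerivAt_id t).pow 2).neg.exp).div_const 2).neg
      convert! this using 1
      simp
      ring
    · have h1 : Tendsto (fun t : ℝ => t ^ 2) atTop atTop := tendsto_pow_atTop two_ne_zero
      have h2 := Real.tendsto_exp_neg_atTop_nhds_zero.comp h1
      simpa using (h2.div_const 2).neg
  have hxJ : x * ∫ t in Ioi x, Real.exp (-t ^ 2) ≤ ∫ t in Ioi x, t * Real.exp (-t ^ 2) := by
    rw [← integral_const_mul]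
    refine setIntegral_mono_on (hint.const_mul x).integrableOn hint2.integrableOn
      measurableSet_Ioi fun t ht => ?_
    exact mul_le_mul_of_nonneg_right (le_of_lt ht) (Real.exp_pos _).le
  have hs : 1 ≤ Real.sqrt Real.pi := by
    rw [Real.one_le_sqrt]; linarith [Real.pi_gt_three]
  have he : Real.exp (-x ^ 2) ≤ 1 := Real.exp_le_one_iff.2 (by nlinarith)
  unfold rho erf
  generalize (∫ t in Ioi x, Real.exp (-t ^ 2)) = J at *
  have hI : (∫ t in (0 : ℝ)..x, Real.exp (-t ^ 2)) = Real.sqrt Real.pi / 2 - J := by linarith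
  rw [hI]
  generalize Real.sqrt Real.pi = s at *
  have hs0 : 0 < s := by linarith
  have e : x * (2 / s * (s / 2 - J)) + Real.exp (-x ^ 2) / s - x
      = (Real.exp (-x ^ 2) - 2 * (x * J)) / s := by
    field_simp; ring
  rw [e]
  have : 0 ≤ x * J := mul_nonneg hx hJ0
  constructor
  · apply div_nonneg _ hs0.le
    linarith
  · rw [div_le_one hs0]; linarith

lemma rho_neg' (x : ℝ) : rho (-x) = rho x := by
  have : erf (-x) = -erf x := by
    unfold erf
    have h := intervalIntegral.integral_comp_neg (a := 0) (b := x)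
      (fun t : ℝ => Real.exp (-t ^ 2))
    simp only [neg_sq, neg_zero] at h
    rw [h, intervalIntegral.integral_symm (-x) 0]
    ring
  unfold rho
  rw [this]
  simp

lemma rho_bound (x : ℝ) : 0 ≤ rho x - |x| ∧ rho x - |x| ≤ 1 := by
  rcases abs_cases x with ⟨h, _⟩ | ⟨h, h2⟩
  · rw [h]; exact rho_bound_nonneg x ‹_›
  · rw [h, ← rho_neg']; exact rho_bound_nonneg (-x) (by linarith)

lemma hasDerivAt_erf' (x : ℝ) :
    HasDerivAt erf (2 / Real.sqrt Real.pi * Real.exp (-x ^ 2)) x := by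
  have hc : Continuous (fun t : ℝ => Real.exp (-t ^ 2)) := by fun_prop
  exact (hc.integral_hasStrictDerivAt 0 x).hasDerivAt.const_mul _

lemma hasDerivAt_rho (x : ℝ) : HasDerivAt rho (erf x) x := by
  have h := ((hasDerivAt_id x).mul (hasDerivAt_erf' x)).add
    ((((hasDerivAt_id x).pow 2).neg.exp).div_const (Real.sqrt Real.pi))
  convert! h using 1
  simp
  ring

lemma erf_mono : Monotone erf := by
  refine monotone_of_deriv_nonneg (fun x => (hasDerivAt_erf' x).differentiableAt) fun x => ?_
  rw [(hasDerivAt_erf' x).deriv]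
  positivity

lemma convexOn_rho : ConvexOn ℝ Set.univ rho := by
  refine Monotone.convexOn_univ_of_deriv (fun x => (hasDerivAt_rho x).differentiableAt) ?_
  have : deriv rho = erf := funext fun x => (hasDerivAt_rho x).deriv
  rw [this]; exact erf_mono

lemma analyticAt_erf (x : ℝ) : AnalyticAt ℝ erf x := by
  have hd : Differentiable ℂ (fun z : ℂ => Complex.exp (-z ^ 2)) := by fun_prop
  obtain ⟨F, hF⟩ := hd.isExactOn_univ
  have hFd : Differentiable ℂ F := fun z => (hF z (Set.mem_univ _)).differentiableAt
  have ha : AnalyticAt ℝ (fun y : ℝ => (F y).re) x := (hFd.analyticAt (x : ℂ)).re_ofReal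
  have hder : ∀ y : ℝ, HasDerivAt (fun y : ℝ => (F y).re) (Real.exp (-y ^ 2)) y := by
    intro y
    have h := (hF (y : ℂ) (Set.mem_univ _)).real_of_complex
    convert! h using 1
    beta_reduce
    rw [← Complex.ofReal_pow, ← Complex.ofReal_neg, Complex.exp_ofReal_re]
  have hc : Continuous (fun t : ℝ => Real.exp (-t ^ 2)) := by fun_prop
  have e : erf = fun y : ℝ => 2 / Real.sqrt Real.pi * ((F y).re - (F (0 : ℝ)).re) := by
    funext y
    unfold erf
    rw [intervalIntegral.integral_eq_sub_of_hasDerivAt (fun t _ => hder t)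
      (hc.intervalIntegrable _ _)]
  rw [e]
  exact analyticAt_const.mul (ha.sub analyticAt_const)

lemma analyticAt_rho (x : ℝ) : AnalyticAt ℝ rho x := by
  have h1 : AnalyticAt ℝ (fun y : ℝ => Real.exp (-y ^ 2)) x := by fun_prop
  exact (analyticAt_id.mul (analyticAt_erf x)).add (h1.div_const)

/-- For every `ε > 0` and `δ ≥ 0`, the function `f_ε` is convex on `ℝ`,
real-analytic on all of `ℝ`, and uniformly `ε`-approximates the `δ`-insensitive absolute
loss `|x|_δ = max(0, |x| - δ)`. -/
theorem stmt16 (ε δ : ℝ) (hε : 0 < ε) (hδ : 0 ≤ δ) :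
    ConvexOn ℝ Set.univ (feps ε δ) ∧
      AnalyticOnNhd ℝ (feps ε δ) Set.univ ∧
        ∀ x : ℝ, |feps ε δ x - max 0 (|x| - δ)| ≤ ε := by
  refine ⟨?_, ?_, fun x => ?_⟩
  · have key : ∀ c : ℝ, ConvexOn ℝ Set.univ (fun x => ε / 2 * rho ((x + c) / ε)) := by
      intro c
      refine ⟨convex_univ, fun x _ y _ a b ha hb hab => ?_⟩
      have h := convexOn_rho.2 (Set.mem_univ ((x + c) / ε)) (Set.mem_univ ((y + c) / ε))
        ha hb hab
      simp only [smul_eq_mul] at h ⊢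
      have e : (a * x + b * y + c) / ε = a * ((x + c) / ε) + b * ((y + c) / ε) := by
        have : c = (a + b) * c := by rw [hab, one_mul]
        field_simp
        linear_combination this
      rw [e]
      have := mul_le_mul_of_nonneg_left h (by positivity : 0 ≤ ε / 2)
      linarith
    have h := ((key (-δ)).add (key δ)).add_const (-δ)
    exact h
  · intro x _
    have h1 : AnalyticAt ℝ (fun y : ℝ => rho ((y - δ) / ε)) x :=
      (analyticAt_rho _).comp (f := fun y : ℝ => (y - δ) / ε)
        ((analyticAt_id.sub analyticAt_const).div_const)
    have h2 : AnalyticAt ℝ (fun y : ℝ => rho ((y + δ) / ε)) x :=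
      (analyticAt_rho _).comp (f := fun y : ℝ => (y + δ) / ε)
        ((analyticAt_id.add analyticAt_const).div_const)
    exact ((analyticAt_const.mul h1).add (analyticAt_const.mul h2)).sub analyticAt_const
  · obtain ⟨a1, a2⟩ := rho_bound ((x - δ) / ε)
    obtain ⟨b1, b2⟩ := rho_bound ((x + δ) / ε)
    have hm : max 0 (|x| - δ) = |x - δ| / 2 + |x + δ| / 2 - δ := by
      rcases max_cases 0 (|x| - δ) with h | h <;> rcases abs_cases x with h1 | h1 <;>
      rcases abs_cases (x - δ) with h2 | h2 <;> rcases abs_cases (x + δ) with h3 | h3 <;>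
      linarith
    have ea : |x - δ| = ε * |(x - δ) / ε| := by
      rw [abs_div, abs_of_pos hε]; field_simp
    have eb : |x + δ| = ε * |(x + δ) / ε| := by
      rw [abs_div, abs_of_pos hε]; field_simp
    have e : feps ε δ x - max 0 (|x| - δ)
        = ε / 2 * (rho ((x - δ) / ε) - |(x - δ) / ε|)
          + ε / 2 * (rho ((x + δ) / ε) - |(x + δ) / ε|) := by
      rw [hm, ea, eb]; unfold feps; ring
    rw [e, abs_le]
    constructor <;> nlinarith
end

section
/- Let δ = 1/100000, let d, k be positive integers with k <= d, let ε = 1/sqrt(k), let T be a subset of {1,...,d} with |T| = k, let r_i in {-1, +1} for i in T, and define L(w) = (1/k) Σ_{i in T} (1 - r_i · w[i])^2. Then every w in R^d with ||w||_2 <= 1 and L(w) <= 1 - 2(1-δ)ε satisfies: (i) Σ_{i in T} w[i]^2 >= 1 - 2δ, and (ii) the number of indices i in T with |w[i]| >= ε/10 is at least k/10. -/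
open scoped Classical

/-- Lower-bound construction, structure of near-optimal regressors:
for `δ = 1/100000`, `1 ≤ k ≤ d`, `ε = 1/√k`, a set `T ⊆ {1,…,d}` with `|T| = k` and signs
`r_i ∈ {±1}`, every `w ∈ ℝ^d` with `‖w‖₂ ≤ 1` and expected loss
`L(w) = (1/k) Σ_{i ∈ T} (1 - r_i w[i])² ≤ 1 - 2(1-δ)ε` satisfies
(i) `Σ_{i ∈ T} w[i]² ≥ 1 - 2δ`, and
(ii) at least `k/10` indices `i ∈ T` have `|w[i]| ≥ ε/10`. -/
theorem stmt19 (d k : ℕ) (hk1 : 1 ≤ k) (hkd : k ≤ d)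
    (δ : ℝ) (hδ : δ = 1 / 100000)
    (ε : ℝ) (hε : ε = 1 / Real.sqrt k)
    (T : Finset (Fin d)) (hT : T.card = k)
    (r : Fin d → ℝ) (hr : ∀ i ∈ T, r i = 1 ∨ r i = -1)
    (w : EuclideanSpace ℝ (Fin d)) (hw : ‖w‖ ≤ 1)
    (hL : (k : ℝ)⁻¹ * ∑ i ∈ T, (1 - r i * w i) ^ 2 ≤ 1 - 2 * (1 - δ) * ε) :
    (1 - 2 * δ ≤ ∑ i ∈ T, (w i) ^ 2) ∧
      (k : ℝ) / 10 ≤ ((T.filter fun i => ε / 10 ≤ |w i|).card : ℝ) := by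
  have hk0 : (0:ℝ) < k := by exact_mod_cast hk1
  obtain ⟨s, hs⟩ : ∃ s, s = Real.sqrt k := ⟨_, rfl⟩
  have hs0 : 0 < s := by rw [hs]; exact Real.sqrt_pos.mpr hk0
  have hss : s * s = k := by rw [hs]; exact Real.mul_self_sqrt hk0.le
  rw [← hs] at hε
  have hεs : ε * s = 1 := by rw [hε]; field_simp
  have hε0 : 0 < ε := by rw [hε]; positivity
  have hkε : k * ε = s := by rw [← hss, mul_assoc, mul_comm s ε, hεs, mul_one]
  have hr2 : ∀ i ∈ T, (r i * w i) ^ 2 = w i ^ 2 := by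
    intro i hi
    rcases hr i hi with h | h <;> rw [h] <;> ring
  have hexp : ∑ i ∈ T, (1 - r i * w i) ^ 2
      = k - 2 * ∑ i ∈ T, r i * w i + ∑ i ∈ T, w i ^ 2 := by
    have h1 : ∑ i ∈ T, (1 - r i * w i) ^ 2
        = ∑ i ∈ T, (1 - 2 * (r i * w i) + w i ^ 2) := by
      refine Finset.sum_congr rfl fun i hi => ?_
      rw [← hr2 i hi]; ring
    rw [h1, Finset.sum_add_distrib, Finset.sum_sub_distrib, ← Finset.mul_sum]
    simp [hT]
  have hL2 : ∑ i ∈ T, (1 - r i * w i) ^ 2 ≤ k * (1 - 2 * (1 - δ) * ε) := by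
    rwa [inv_mul_le_iff₀ hk0] at hL
  have hS0 : 0 ≤ ∑ i ∈ T, w i ^ 2 := Finset.sum_nonneg fun i _ => sq_nonneg _
  have hA : (1 - δ) * s ≤ ∑ i ∈ T, r i * w i := by
    have : (k:ℝ) * (1 - 2 * (1 - δ) * ε) = k - 2 * (1 - δ) * s := by rw [← hkε]; ring
    linarith
  have hfull : ∑ i, w i ^ 2 ≤ 1 := by
    have h := EuclideanSpace.real_norm_sq_eq w
    rw [← h]
    exact pow_le_one₀ (norm_nonneg _) hw
  constructor
  · have hcs : (∑ i ∈ T, r i * w i) ^ 2 ≤ k * ∑ i ∈ T, w i ^ 2 := by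
      have h := sq_sum_le_card_mul_sum_sq (s := T) (f := fun i => r i * w i)
      rw [hT, Finset.sum_congr rfl hr2] at h
      exact h
    have h2 : ((1 - δ) * s) ^ 2 ≤ (∑ i ∈ T, r i * w i) ^ 2 := by
      refine pow_le_pow_left₀ ?_ hA 2
      rw [hδ]; nlinarith
    have h3 : k * (1 - δ) ^ 2 ≤ k * ∑ i ∈ T, w i ^ 2 := by
      rw [← hss] at hcs ⊢; nlinarith
    have h4 := le_of_mul_le_mul_left h3 hk0
    nlinarith [sq_nonneg δ]
  · set F := T.filter fun i => ε / 10 ≤ |w i| with hF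
    have hB : ∑ i ∈ T, r i * w i ≤ ∑ i ∈ F, |w i| + s / 10 := by
      have h1 : ∑ i ∈ T, r i * w i
          ≤ ∑ i ∈ T, ((if ε / 10 ≤ |w i| then |w i| else 0) + ε / 10) := by
        refine Finset.sum_le_sum fun i hi => ?_
        have h : r i * w i ≤ |w i| := by
          rcases hr i hi with h | h <;> rw [h]
          · simpa using le_abs_self (w i)
          · simpa using neg_le_abs (w i)
        split_ifs with hc <;> linarith
      rw [Finset.sum_add_distrib, ← Finset.sum_filter, Finset.sum_const, hT, nsmul_eq_mul] at h1
      have : (k:ℝ) * (ε / 10) = s / 10 := by rw [← hkε]; ring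
      linarith
    have hcs : (∑ i ∈ F, |w i|) ^ 2 ≤ F.card * ∑ i ∈ F, w i ^ 2 := by
      have h := sq_sum_le_card_mul_sum_sq (s := F) (f := fun i => |w i|)
      simpa only [sq_abs] using h
    have hFS : ∑ i ∈ F, w i ^ 2 ≤ 1 :=
      (Finset.sum_le_univ_sum_of_nonneg fun i => sq_nonneg _).trans hfull
    have hN : (F.card : ℝ) * ∑ i ∈ F, w i ^ 2 ≤ F.card :=
      mul_le_of_le_one_right (Nat.cast_nonneg _) hFS
    have hB2 : s / 2 ≤ ∑ i ∈ F, |w i| := by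
      rw [hδ] at hA; linarith
    have h5 : (s / 2) ^ 2 ≤ (∑ i ∈ F, |w i|) ^ 2 := pow_le_pow_left₀ (by positivity) hB2 2
    nlinarith
end
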